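/- arXiv:2101.06743 — 6 statements merged into one kernel-verified Lean document; each statement's English description precedes it below -/
import Mathlib

section
/- For every integer k ≥ 2 there exists a constant c > 0 such that for all sufficiently large n there exists a 3-uniform hypergraph on n vertices with at least c · n^{2 + 1/(2k−1)} triples that contains no copy of C̃_{2k}; equivalently, ex_3(n, C̃_{2k}) ≥ c · n^{2 + 1/(2k−1)} for all sufficiently large n. -/
open scoped Classical

namespace Paper

/-- `G` contains a copy of `F` (an injective graph homomorphism of `F` into `G`). -/
def HasGraphCopy {α β : Type*} (F : SimpleGraph α) (G : SimpleGraph β) : Prop :=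
  ∃ f : α ↪ β, ∀ u v, F.Adj u v → G.Adj (f u) (f v)

/-- The 3-uniform hypergraph `H` contains a copy of the 3-uniform hypergraph `F`. -/
def HasHypCopy {α β : Type*} (F : Set (Finset α)) (H : Set (Finset β)) : Prop :=
  ∃ f : α ↪ β, ∀ e ∈ F, e.map f ∈ H

/-- The suspension `Ĝ` of a graph `G`: a new vertex (`none`) joined to all vertices of `G`. -/
def suspension {α : Type*} (G : SimpleGraph α) : SimpleGraph (Option α) :=
  SimpleGraph.fromRel (fun x y => x = none ∨ ∃ u v, x = some u ∧ y = some v ∧ G.Adj u v)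

/-- The hypergraph suspension `G̃` of a graph `G`: the triples `{x, u, v}` over edges `uv` of `G`,
where `x = none` is a new vertex. -/
def hypSuspension {α : Type*} (G : SimpleGraph α) : Set (Finset (Option α)) :=
  {e | ∃ u v, G.Adj u v ∧ e = {none, some u, some v}}

/-- `ex(n, K₃, F)`: the maximum number of triangles in an `F`-free graph on `n` vertices. -/
noncomputable def exTriangles {α : Type*} (n : ℕ) (F : SimpleGraph α) : ℕ :=
  sSup {t | ∃ G : SimpleGraph (Fin n),
    ¬ HasGraphCopy F G ∧ t = {s : Finset (Fin n) | G.IsNClique 3 s}.ncard}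

/-- `ex₃(n, F)`: the maximum number of triples in an `F`-free 3-uniform hypergraph on `n`
vertices. -/
noncomputable def ex3 {α : Type*} (n : ℕ) (F : Set (Finset α)) : ℕ :=
  sSup {t | ∃ H : Finset (Finset (Fin n)), (∀ e ∈ H, e.card = 3) ∧
    ¬ HasHypCopy F (↑H : Set (Finset (Fin n))) ∧ t = H.card}

/-- `ex(n, C_m)`: the maximum number of edges in a graph on `n` vertices with no cycle of
length `m`. -/
noncomputable def exCycle (n m : ℕ) : ℕ :=
  sSup {t | ∃ G : SimpleGraph (Fin n),
    ¬ HasGraphCopy (SimpleGraph.cycleGraph m) G ∧ t = G.edgeSet.ncard}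

/-- The link of a vertex `x` in a 3-uniform hypergraph `H`: `u ~ v` iff `{x, u, v} ∈ H`. -/
def linkGraph {V : Type*} (H : Set (Finset V)) (x : V) : SimpleGraph V :=
  SimpleGraph.fromRel (fun u v => u ≠ x ∧ v ≠ x ∧ ({x, u, v} : Finset V) ∈ H)

/-!  Coordinates of a vector are labelled `x_1, x_{11}, x_{12}, x_{21}, x_{22}, x'_{22}, x_{23},
x_{32}, x_{33}, x'_{33}, x_{34}, x_{43}, …` and indexed `0, 1, 2, …`.  The `j`-th defining
equation (`j ≥ 1`) of the graph `D(q)` has the form `a_j + b_j + a_{aIdx j} * b_{bIdx j} = 0`. -/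

/-- Index of the `a`-coordinate in the product term of the `j`-th equation. -/
def aIdx : ℕ → ℕ
  | 1 => 0
  | 2 => 0
  | 3 => 1
  | j => if j % 4 = 0 ∨ j % 4 = 3 then j - 2 else 0

/-- Index of the `b`-coordinate in the product term of the `j`-th equation. -/
def bIdx : ℕ → ℕ
  | 1 => 0
  | 2 => 1
  | 3 => 0
  | j => if j % 4 = 0 ∨ j % 4 = 3 then 0 else j - 2

/-- Index of the extra linear term in the `j`-th equation of `D'(q)` (for `j ≥ 2`). -/
def linIdx : ℕ → ℕ
  | 2 => 1
  | j => j - 2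

/-- Extend a vector in `F^k` to an `ℕ`-indexed sequence by zeros. -/
def ext {k : ℕ} {F : Type*} [Zero F] (a : Fin k → F) (j : ℕ) : F :=
  if h : j < k then a ⟨j, h⟩ else 0

/-- The defining relation of the 3-graph `D₃(k,q)`: the first `k-1` equations. -/
def D3rel (k : ℕ) (F : Type*) [CommRing F] (a b c : Fin k → F) : Prop :=
  ∀ j : ℕ, 1 ≤ j → j < k →
    ext a j + ext b j + ext c j
      + ext a (aIdx j) * ext b (bIdx j)
      + ext b (aIdx j) * ext c (bIdx j)
      + ext c (aIdx j) * ext a (bIdx j) = 0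

/-- The defining relation of the bipartite graph `D(k,q)`: the first `k-1` equations. -/
def Drel (k : ℕ) (F : Type*) [CommRing F] (a b : Fin k → F) : Prop :=
  ∀ j : ℕ, 1 ≤ j → j < k →
    ext a j + ext b j + ext a (aIdx j) * ext b (bIdx j) = 0

/-- The defining relation of the bipartite graph `D'(k,q)`: the first `k-1` equations. -/
def D'rel (k : ℕ) (F : Type*) [CommRing F] (a b : Fin k → F) : Prop :=
  ∀ j : ℕ, 1 ≤ j → j < k →
    if j = 1 then
      ext a 1 - ext a 0 + ext b 1 - ext b 0 + ext a 0 * ext b 0 = 0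
    else
      ext a j + ext a (linIdx j) + ext b j + ext b (linIdx j)
        + ext a (aIdx j) * ext b (bIdx j) = 0

/-- The bipartite graph `D(k,q)` on two copies of `F^k`. -/
def DGraph (k : ℕ) (F : Type*) [CommRing F] :
    SimpleGraph ((Fin k → F) ⊕ (Fin k → F)) :=
  SimpleGraph.fromRel (fun x y => ∃ a b, x = Sum.inl a ∧ y = Sum.inr b ∧ Drel k F a b)

/-- The bipartite graph `D'(k,q)` on two copies of `F^k`. -/
def D'Graph (k : ℕ) (F : Type*) [CommRing F] :
    SimpleGraph ((Fin k → F) ⊕ (Fin k → F)) :=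
  SimpleGraph.fromRel (fun x y => ∃ a b, x = Sum.inl a ∧ y = Sum.inr b ∧ D'rel k F a b)

/-- `{a,b,c}`-membership for the link of a vertex `v` lying in part `p` of `D₃(k,q)`:
for `p = 0` (part `A`) the two remaining parts are `B, C`; for `p = 1` (part `B`) they are
`C, A`; for `p = 2` (part `C`) they are `A, B`. -/
def D3edgeProp (k : ℕ) (F : Type*) [CommRing F] (p : Fin 3) (v u w : Fin k → F) : Prop :=
  if p = 0 then D3rel k F v u w
  else if p = 1 then D3rel k F w v u
  else D3rel k F u w v

/-- The link of the vertex `v` in part `p` of the 3-partite 3-graph `D₃(k,q)`, as a bipartite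
graph on the two remaining parts. -/
def linkD3 (k : ℕ) (F : Type*) [CommRing F] (p : Fin 3) (v : Fin k → F) :
    SimpleGraph ((Fin k → F) ⊕ (Fin k → F)) :=
  SimpleGraph.fromRel
    (fun x y => ∃ u w, x = Sum.inl u ∧ y = Sum.inr w ∧ D3edgeProp k F p v u w)


/-- The functions into `Fin q` vanishing on `b` form a `q ^ (-b.card)` fraction of all. -/
theorem card_filter_eq_zero_on_mul_pow {α : Type*} [Fintype α] (q : ℕ) [NeZero q]
    (b : Finset α) :
    (Finset.univ.filter fun g : α → Fin q => ∀ t ∈ b, g t = 0).card * q ^ b.card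
      = q ^ Fintype.card α := by
  have h : (Finset.univ.filter fun g : α → Fin q => ∀ t ∈ b, g t = 0)
      = Fintype.piFinset fun t => if t ∈ b then {0} else Finset.univ := by
    ext g
    simp only [Finset.mem_filter, Finset.mem_univ, true_and, Fintype.mem_piFinset]
    refine forall_congr' fun t => ?_
    by_cases ht : t ∈ b <;> simp [ht]
  have hcard : ∀ t, (if t ∈ b then ({0} : Finset (Fin q)) else Finset.univ).card
      = if t ∈ b then 1 else q := by
    intro t
    split_ifs <;> simp
  rw [h, Fintype.card_piFinset]
  simp only [hcard]
  rw [Finset.prod_ite, Finset.prod_const_one, one_mul, Finset.prod_const, ← pow_add]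
  congr 1
  have := Finset.card_filter_add_card_filter_not (s := (Finset.univ : Finset α)) (fun t => t ∈ b)
  rw [Finset.filter_univ_mem, Finset.card_univ] at this
  omega

/-- The deletion method: if `B` is a family of `m`-subsets, then keeping each element of `T` with
probability `1 / q` and deleting one element of each surviving member of `B` leaves a large subset
of `T` containing no member of `B`. -/
theorem exists_large_subset_avoiding {α : Type*} [Fintype α] (T : Finset α)
    (B : Finset (Finset α)) (m q : ℕ) (hq : 0 < q) (hm : 0 < m) (hB : ∀ b ∈ B, b.card = m) :
    ∃ S ⊆ T, (∀ b ∈ B, ¬ b ⊆ S) ∧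
      (q : ℝ) ^ (m - 1) * T.card - B.card ≤ (q : ℝ) ^ m * S.card := by
  have : NeZero q := ⟨hq.ne'⟩
  let K : (α → Fin q) → Finset α := fun g => T.filter fun t => g t = 0
  let D : (α → Fin q) → Finset (Finset α) := fun g => B.filter fun b => ∀ t ∈ b, g t = 0
  have hcount : ∀ b : Finset α,
      ∑ g : α → Fin q, (if ∀ t ∈ b, g t = 0 then (1 : ℝ) else 0) * (q : ℝ) ^ b.card
        = (q : ℝ) ^ Fintype.card α := by
    intro b
    rw [← Finset.sum_mul, Finset.sum_boole]
    exact_mod_cast card_filter_eq_zero_on_mul_pow q b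
  have hK : ∑ g, (q : ℝ) * ((K g).card : ℝ) = T.card * (q : ℝ) ^ Fintype.card α := by
    simp only [K, Finset.card_filter, Nat.cast_sum, Finset.mul_sum]
    rw [Finset.sum_comm, ← nsmul_eq_mul, ← Finset.sum_const]
    refine Finset.sum_congr rfl fun t _ => ?_
    simpa [mul_comm] using hcount {t}
  have hD : ∑ g, (q : ℝ) ^ m * ((D g).card : ℝ) = B.card * (q : ℝ) ^ Fintype.card α := by
    simp only [D, Finset.card_filter, Nat.cast_sum, Finset.mul_sum]
    rw [Finset.sum_comm, ← nsmul_eq_mul, ← Finset.sum_const]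
    refine Finset.sum_congr rfl fun b hb => ?_
    rw [← hcount b, hB b hb]
    refine Finset.sum_congr rfl fun g _ => ?_
    rw [mul_comm]
    push_cast
    rfl
  have hpow : (q : ℝ) ^ m = (q : ℝ) ^ (m - 1) * q := by
    rw [← pow_succ, Nat.sub_add_cancel hm]
  obtain ⟨g, -, hg⟩ : ∃ g ∈ (Finset.univ : Finset (α → Fin q)),
      (q : ℝ) ^ (m - 1) * T.card - B.card
        ≤ (q : ℝ) ^ (m - 1) * (q * ((K g).card : ℝ)) - (q : ℝ) ^ m * ((D g).card : ℝ) := by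
    refine Finset.exists_le_of_sum_le Finset.univ_nonempty (le_of_eq ?_)
    rw [Finset.sum_sub_distrib, Finset.sum_sub_distrib, ← Finset.mul_sum _ _ ((q : ℝ) ^ (m - 1)),
      ← Finset.mul_sum _ _ ((q : ℝ) ^ (m - 1)), hK, hD, Finset.sum_const, Finset.sum_const,
      Finset.card_univ, Fintype.card_fun, Fintype.card_fin, nsmul_eq_mul]
    push_cast
    ring
  have hsel : ∀ b : Finset α, ∃ t : Finset α, t.card ≤ 1 ∧ (b ∈ B → ∃ a ∈ b, a ∈ t) := by
    intro b
    by_cases hb : b ∈ B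
    · obtain ⟨a, ha⟩ : b.Nonempty := Finset.card_pos.1 (by rw [hB b hb]; exact hm)
      exact ⟨{a}, by simp, fun _ => ⟨a, ha, by simp⟩⟩
    · exact ⟨∅, by simp, fun h => absurd h hb⟩
  choose p hp1 hp using hsel
  refine ⟨K g \ (D g).biUnion p, Finset.sdiff_subset.trans (Finset.filter_subset _ _), ?_, ?_⟩
  · intro b hb hbS
    have hbD : b ∈ D g := Finset.mem_filter.2 ⟨hb, fun t ht =>
      (Finset.mem_filter.1 (Finset.mem_sdiff.1 (hbS ht)).1).2⟩
    obtain ⟨a, hab, hap⟩ := hp b hb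
    exact (Finset.mem_sdiff.1 (hbS hab)).2 (Finset.mem_biUnion.2 ⟨b, hbD, hap⟩)
  · have h1 : (K g).card ≤ (K g \ (D g).biUnion p).card + (D g).card := by
      have h2 := Finset.le_card_sdiff ((D g).biUnion p) (K g)
      have h3 : ((D g).biUnion p).card ≤ (D g).card := by
        simpa using Finset.card_biUnion_le_card_mul (D g) p 1 fun b _ => hp1 b
      omega
    have h4 : ((K g).card : ℝ) ≤ (K g \ (D g).biUnion p).card + (D g).card := by exact_mod_cast h1
    have h5 := mul_le_mul_of_nonneg_left h4 (pow_nonneg (Nat.cast_nonneg (α := ℝ) q) m)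
    rw [hpow] at *
    linarith

/-- The triple of the suspension of the cycle on `Fin m` formed by the apex and the
edge from `i` to `i + 1`. -/
noncomputable def coneTriple (m : ℕ) [NeZero m] (i : Fin m) : Finset (Option (Fin m)) :=
  {none, some i, some (i + 1)}

theorem coneTriple_injective {m : ℕ} [NeZero m] (hm : 3 ≤ m) :
    Function.Injective (coneTriple m) := by
  intro i j h
  by_contra hij
  have hi : some i ∈ coneTriple m j := h ▸ by simp [coneTriple]
  have hi' : some j ∈ coneTriple m i := h ▸ by simp [coneTriple]
  simp only [coneTriple, Finset.mem_insert, Finset.mem_singleton, reduceCtorEq, false_or,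
    Option.some.injEq] at hi hi'
  have h1 : i = j + 1 := hi.resolve_left hij
  have h2 : j = i + 1 := hi'.resolve_left (Ne.symm hij)
  have h3 : (1 + 1 : Fin m) = 0 := by
    have : j + (1 + 1) = j := by rw [← add_assoc, ← h1, ← h2]
    simpa using this
  obtain ⟨l, rfl⟩ : ∃ l, m = l + 3 := ⟨m - 3, by omega⟩
  simp [Fin.ext_iff, Fin.val_add] at h3
  rw [Nat.mod_eq_of_lt (by omega)] at h3
  omega

theorem coneTriple_mem_hypSuspension {m : ℕ} [NeZero m] (hm : 2 ≤ m) (i : Fin m) :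
    coneTriple m i ∈ hypSuspension (SimpleGraph.cycleGraph m) := by
  refine ⟨i, i + 1, ?_, ?_⟩
  · obtain ⟨l, rfl⟩ : ∃ l, m = l + 2 := ⟨m - 2, by omega⟩
    rw [SimpleGraph.cycleGraph_adj]
    right
    simp
  · ext x
    simp [coneTriple]

/-- The triples of the copy of the suspension of the cycle on `Fin m` given by `f`. -/
noncomputable def copyTriples {β : Type*} (m : ℕ) [NeZero m] (f : Option (Fin m) ↪ β) :
    Finset (Finset β) :=
  Finset.univ.image fun i => (coneTriple m i).map f

theorem mem_copyTriples {β : Type*} {m : ℕ} [NeZero m] {f : Option (Fin m) ↪ β} {e : Finset β} :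
    e ∈ copyTriples m f ↔ ∃ i, (coneTriple m i).map f = e := by
  simp [copyTriples]

theorem card_copyTriples {β : Type*} {m : ℕ} [NeZero m] (hm : 3 ≤ m) (f : Option (Fin m) ↪ β) :
    (copyTriples m f).card = m := by
  rw [copyTriples, Finset.card_image_of_injective, Finset.card_univ, Fintype.card_fin]
  exact (Finset.map_injective f).comp (coneTriple_injective hm)

/-- A hypergraph on `n` vertices free of the suspension of `C_m`, as given by the deletion
method with probability `1 / q`. -/
theorem exists_suspension_free_of_deletion {m : ℕ} (hm : 3 ≤ m) (n q : ℕ) (hq : 0 < q) :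
    ∃ H : Finset (Finset (Fin n)), (∀ e ∈ H, e.card = 3) ∧
      ¬ HasHypCopy (hypSuspension (SimpleGraph.cycleGraph m)) (↑H : Set (Finset (Fin n))) ∧
      (q : ℝ) ^ (m - 1) * n.choose 3 - (n : ℝ) ^ (m + 1) ≤ (q : ℝ) ^ m * H.card := by
  have : NeZero m := ⟨by omega⟩
  let B : Finset (Finset (Finset (Fin n))) := Finset.univ.image (copyTriples (β := Fin n) m)
  have hB : ∀ b ∈ B, b.card = m := by
    intro b hb
    obtain ⟨f, -, rfl⟩ := Finset.mem_image.1 hb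
    exact card_copyTriples hm f
  have hBcard : B.card ≤ n ^ (m + 1) := by
    refine Finset.card_image_le.trans ?_
    rw [Finset.card_univ, Fintype.card_embedding_eq, Fintype.card_option, Fintype.card_fin,
      Fintype.card_fin]
    exact Nat.descFactorial_le_pow _ _
  obtain ⟨H, hHT, hHB, hH⟩ := exists_large_subset_avoiding
    (Finset.powersetCard 3 (Finset.univ : Finset (Fin n))) B m q hq (by omega) hB
  refine ⟨H, fun e he => (Finset.mem_powersetCard.1 (hHT he)).2, ?_, ?_⟩
  · rintro ⟨f, hf⟩
    refine hHB (copyTriples m f) (Finset.mem_image_of_mem _ (Finset.mem_univ f)) ?_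
    intro e he
    obtain ⟨i, rfl⟩ := mem_copyTriples.1 he
    exact hf _ (coneTriple_mem_hypSuspension (by omega) i)
  · rw [Finset.card_powersetCard, Finset.card_univ, Fintype.card_fin] at hH
    have : (B.card : ℝ) ≤ (n : ℝ) ^ (m + 1) := by exact_mod_cast hBcard
    linarith

theorem pow_three_div_twelve_le_choose {n : ℕ} (hn : 6 ≤ n) :
    (n : ℝ) ^ 3 / 12 ≤ n.choose 3 := by
  have hn' : (6 : ℝ) ≤ n := by exact_mod_cast hn
  have h : (n.choose 3 : ℝ) = n * (n - 1) * (n - 2) / 6 := by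
    rw [Nat.cast_choose_eq_descPochhammer_div]
    simp [descPochhammer_succ_right, Nat.factorial]
  rw [h]
  nlinarith [mul_nonneg (sub_nonneg.2 hn') (by positivity : (0 : ℝ) ≤ (n : ℝ) ^ 2),
    mul_nonneg (sub_nonneg.2 hn') (by positivity : (0 : ℝ) ≤ (n : ℝ))]

theorem exists_suspension_free_card_ge {m n : ℕ} (hm : 3 ≤ m) (hn : 6 ≤ n) :
    ∃ H : Finset (Finset (Fin n)), (∀ e ∈ H, e.card = 3) ∧
      ¬ HasHypCopy (hypSuspension (SimpleGraph.cycleGraph m)) (↑H : Set (Finset (Fin n))) ∧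
      1 / 600 * (n : ℝ) ^ ((2 : ℝ) + 1 / ((m : ℝ) - 1)) ≤ (H.card : ℝ) := by
  have hm' : (3 : ℝ) ≤ m := by exact_mod_cast hm
  have hm1 : (0 : ℝ) < (m : ℝ) - 1 := by linarith
  have hn' : (6 : ℝ) ≤ n := by exact_mod_cast hn
  have hn0 : (0 : ℝ) < n := by linarith
  set a : ℝ := 1 - 1 / ((m : ℝ) - 1) with ha
  have ha0 : 0 ≤ a := by
    rw [ha, sub_nonneg, div_le_one hm1]
    linarith
  set y : ℝ := (n : ℝ) ^ a with hy
  have hy1 : 1 ≤ y := Real.one_le_rpow (by linarith) ha0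
  have hypow : y ^ (m - 1) = (n : ℝ) ^ (m - 2) := by
    rw [hy, ← Real.rpow_natCast, ← Real.rpow_mul hn0.le, ← Real.rpow_natCast]
    congr 1
    rw [Nat.cast_sub (by omega), Nat.cast_sub (by omega), ha]
    push_cast
    field_simp
    ring
  have hyexp : (n : ℝ) ^ ((2 : ℝ) + 1 / ((m : ℝ) - 1)) * y = (n : ℝ) ^ 3 := by
    rw [hy, ← Real.rpow_add hn0, ← Real.rpow_natCast]
    congr 1
    rw [ha]
    push_cast
    ring
  set q : ℕ := ⌈24 * y⌉₊ with hq
  have hq1 : 24 * y ≤ q := Nat.le_ceil _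
  have hq2 : (q : ℝ) ≤ 25 * y := by
    have := Nat.ceil_lt_add_one (by linarith : 0 ≤ 24 * y)
    linarith
  have hq0 : (0 : ℝ) < q := by linarith
  obtain ⟨H, hH3, hHfree, hH⟩ :=
    exists_suspension_free_of_deletion hm n q (by exact_mod_cast hq0)
  refine ⟨H, hH3, hHfree, ?_⟩
  have hchoose := pow_three_div_twelve_le_choose hn
  have hqpow : 24 * (n : ℝ) ^ (m - 2) ≤ (q : ℝ) ^ (m - 1) := by
    calc 24 * (n : ℝ) ^ (m - 2) ≤ 24 ^ (m - 1) * (n : ℝ) ^ (m - 2) := by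
          gcongr
          exact le_self_pow₀ (by norm_num) (by omega)
      _ = (24 * y) ^ (m - 1) := by rw [mul_pow, hypow]
      _ ≤ (q : ℝ) ^ (m - 1) := by gcongr
  have hsplit : (n : ℝ) ^ (m + 1) = (n : ℝ) ^ (m - 2) * (n : ℝ) ^ 3 := by
    rw [← pow_add]
    congr 1
    omega
  have hqm : (q : ℝ) ^ m = (q : ℝ) ^ (m - 1) * q := by
    rw [← pow_succ]
    congr 1
    omega
  have hQ : (0 : ℝ) < (q : ℝ) ^ (m - 1) := by positivity
  have h1 : (q : ℝ) ^ (m - 1) * ((n : ℝ) ^ 3 / 24) ≤ (q : ℝ) ^ (m - 1) * (q * H.card) := by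
    have h2 := mul_le_mul_of_nonneg_left hchoose hQ.le
    have h3 := mul_le_mul_of_nonneg_right hqpow (by positivity : (0 : ℝ) ≤ (n : ℝ) ^ 3)
    rw [hsplit, hqm] at hH
    nlinarith
  have h2 := le_of_mul_le_mul_left h1 hQ
  have h3 : (q : ℝ) * H.card ≤ 25 * y * H.card := by gcongr
  refine le_of_mul_le_mul_right ?_ (by linarith : 0 < y)
  rw [mul_assoc, hyexp]
  linarith

theorem card_le_ex3 {α : Type*} {n : ℕ} {F : Set (Finset α)} {H : Finset (Finset (Fin n))}
    (hH : ∀ e ∈ H, e.card = 3) (hF : ¬ HasHypCopy F (↑H : Set (Finset (Fin n)))) :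
    H.card ≤ ex3 n F := by
  refine le_csSup ⟨Fintype.card (Finset (Fin n)), ?_⟩ ⟨H, hH, hF, rfl⟩
  rintro t ⟨H', -, -, rfl⟩
  exact Finset.card_le_univ H'

/-- For every `k ≥ 2` there is a constant `c > 0` such that for all large `n`
there is a `C̃_{2k}`-free 3-uniform hypergraph on `n` vertices with at least
`c · n^{2 + 1/(2k-1)}` triples; equivalently `ex₃(n, C̃_{2k}) ≥ c · n^{2 + 1/(2k-1)}`. -/
theorem ex3_suspension_cycle_lower (k : ℕ) (hk : 2 ≤ k) :
    ∃ c : ℝ, 0 < c ∧ ∃ N : ℕ, ∀ n : ℕ, N ≤ n →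
      (∃ H : Finset (Finset (Fin n)), (∀ e ∈ H, e.card = 3) ∧
        ¬ HasHypCopy (hypSuspension (SimpleGraph.cycleGraph (2 * k)))
            (↑H : Set (Finset (Fin n))) ∧
        c * (n : ℝ) ^ ((2 : ℝ) + 1 / (2 * (k : ℝ) - 1)) ≤ (H.card : ℝ)) ∧
      c * (n : ℝ) ^ ((2 : ℝ) + 1 / (2 * (k : ℝ) - 1))
        ≤ (ex3 n (hypSuspension (SimpleGraph.cycleGraph (2 * k))) : ℝ) := by
  refine ⟨1 / 600, by norm_num, 6, fun n hn => ?_⟩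
  obtain ⟨H, hH3, hHfree, hH⟩ := exists_suspension_free_card_ge (m := 2 * k) (by omega) hn
  push_cast at hH
  exact ⟨⟨H, hH3, hHfree, hH⟩, hH.trans (by exact_mod_cast card_le_ex3 hH3 hHfree)⟩


end Paper
end

section
/- Let k ≥ 2 and let q be a power of 3. Then the 3-partite 3-uniform hypergraph D_3(k,q) has 3q^k vertices and exactly q^{2k+1} hyperedges. More precisely, for every a ∈ A, b ∈ B and every value c_1 ∈ F_q there exists a unique c ∈ C with first coordinate c_1 such that {a,b,c} is a hyperedge of D_3(k,q). -/
open scoped Classical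

namespace Paper

theorem aIdx_lt {j : ℕ} (hj : 1 ≤ j) : aIdx j < j := by
  unfold aIdx
  split <;> try split
  all_goals omega

theorem bIdx_lt {j : ℕ} (hj : 1 ≤ j) : bIdx j < j := by
  unfold bIdx
  split <;> try split
  all_goals omega

/-- The third vertex of the hyperedge through `a` and `b` with first coordinate `c₁`, computed
one coordinate at a time. -/
def thirdVertex {F : Type*} [CommRing F] (a b : ℕ → F) (c₁ : F) : ℕ → F
  | 0 => c₁
  | j + 1 =>
    -(a (j + 1) + b (j + 1) + a (aIdx (j + 1)) * b (bIdx (j + 1))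
      + b (aIdx (j + 1)) * thirdVertex a b c₁ (bIdx (j + 1))
      + thirdVertex a b c₁ (aIdx (j + 1)) * a (bIdx (j + 1)))
decreasing_by
  · exact bIdx_lt (Nat.le_add_left 1 j)
  · exact aIdx_lt (Nat.le_add_left 1 j)

theorem ext_of_lt {k : ℕ} {F : Type*} [Zero F] (f : ℕ → F) {j : ℕ} (hj : j < k) :
    ext (fun i : Fin k => f i) j = f j := by
  simp [ext, hj]

theorem D3rel.ext_eq_thirdVertex {k : ℕ} {F : Type*} [CommRing F] {a b c : Fin k → F}
    (h : D3rel k F a b c) {j : ℕ} (hj : j < k) :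
    ext c j = thirdVertex (ext a) (ext b) (ext c 0) j := by
  induction j using Nat.strong_induction_on with
  | _ j ih =>
    cases j with
    | zero => rw [thirdVertex]
    | succ j =>
      have hj1 : 1 ≤ j + 1 := Nat.le_add_left 1 j
      rw [thirdVertex, ← ih _ (aIdx_lt hj1) ((aIdx_lt hj1).trans hj),
        ← ih _ (bIdx_lt hj1) ((bIdx_lt hj1).trans hj)]
      linear_combination h (j + 1) hj1 hj

theorem D3rel_thirdVertex {k : ℕ} {F : Type*} [CommRing F] (a b : Fin k → F) (c₁ : F) :
    D3rel k F a b (fun i => thirdVertex (ext a) (ext b) c₁ i) := by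
  intro j hj1 hj
  rw [ext_of_lt _ hj, ext_of_lt _ ((aIdx_lt hj1).trans hj),
    ext_of_lt _ ((bIdx_lt hj1).trans hj)]
  obtain ⟨j, rfl⟩ := Nat.exists_eq_add_of_le' hj1
  rw [thirdVertex]
  ring

theorem existsUnique_D3rel {k : ℕ} (hk : 0 < k) {F : Type*} [CommRing F] (a b : Fin k → F)
    (c₁ : F) : ∃! c : Fin k → F, ext c 0 = c₁ ∧ D3rel k F a b c := by
  refine ⟨fun i => thirdVertex (ext a) (ext b) c₁ i, ⟨?_, D3rel_thirdVertex a b c₁⟩, ?_⟩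
  · rw [ext_of_lt _ hk, thirdVertex]
  · rintro c ⟨rfl, h⟩
    funext i
    simpa [ext] using h.ext_eq_thirdVertex i.isLt

theorem card_D3rel {k : ℕ} (hk : 0 < k) (F : Type*) [CommRing F] [Fintype F] :
    Nat.card {p : (Fin k → F) × (Fin k → F) × (Fin k → F) // D3rel k F p.1 p.2.1 p.2.2}
      = Fintype.card F ^ (2 * k + 1) := by
  have hbij : Function.Bijective
      (fun p : {p : (Fin k → F) × (Fin k → F) × (Fin k → F) // D3rel k F p.1 p.2.1 p.2.2} =>
        (p.1.1, p.1.2.1, ext p.1.2.2 0)) := by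
    constructor
    · rintro ⟨⟨a, b, c⟩, h⟩ ⟨⟨a', b', c'⟩, h'⟩ heq
      simp only [Prod.mk.injEq] at heq
      obtain ⟨rfl, rfl, hc⟩ := heq
      obtain rfl := (existsUnique_D3rel hk a b _).unique ⟨hc, h⟩ ⟨rfl, h'⟩
      rfl
    · rintro ⟨a, b, c₁⟩
      obtain ⟨c, ⟨rfl, h⟩, -⟩ := existsUnique_D3rel hk a b c₁
      exact ⟨⟨(a, b, c), h⟩, rfl⟩
  rw [Nat.card_eq_of_bijective _ hbij]
  simp only [Nat.card_eq_fintype_card, Fintype.card_prod, Fintype.card_fun, Fintype.card_fin]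
  ring

/-- For `k ≥ 2` and `q` a power of `3`, the 3-partite 3-graph `D₃(k,q)` has
`3q^k` vertices and exactly `q^{2k+1}` hyperedges; more precisely, for every `a ∈ A`, `b ∈ B`
and every `c₁ ∈ F_q` there is a unique `c ∈ C` with first coordinate `c₁` such that `{a,b,c}`
is a hyperedge. -/
theorem D3_card_edges (k : ℕ) (hk : 2 ≤ k) (F : Type) [Field F] [Fintype F]
    (m : ℕ) (hm : 0 < m) (hcard : Fintype.card F = 3 ^ m) :
    Fintype.card ((Fin k → F) ⊕ (Fin k → F) ⊕ (Fin k → F)) = 3 * Fintype.card F ^ k ∧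
    Nat.card {p : (Fin k → F) × (Fin k → F) × (Fin k → F) // D3rel k F p.1 p.2.1 p.2.2}
      = Fintype.card F ^ (2 * k + 1) ∧
    (∀ a b : Fin k → F, ∀ c₁ : F, ∃! c : Fin k → F, ext c 0 = c₁ ∧ D3rel k F a b c) := by
  have hk0 : 0 < k := by omega
  refine ⟨?_, card_D3rel hk0 F, existsUnique_D3rel hk0⟩
  simp only [Fintype.card_sum, Fintype.card_fun, Fintype.card_fin]
  ring

end Paper
end

section
/- Let q be a power of 3 and let D_3(3,q) be the 3-partite 3-uniform hypergraph whose parts A, B, C are three disjoint copies of F_q^3, with coordinates written (x_1, x_{11}, x_{12}), where {a,b,c} with a ∈ A, b ∈ B, c ∈ C is a hyperedge if and only if a_{11}+b_{11}+c_{11}+a_1b_1+b_1c_1+c_1a_1 = 0 and a_{12}+b_{12}+c_{12}+a_1b_{11}+b_1c_{11}+c_1a_{11} = 0. Then D_3(3,q) contains no copy of C̃_6; that is, for every vertex x of D_3(3,q), the link of x contains no cycle of length 6. -/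
open scoped Classical

namespace Paper

/-- The relation `D₃(3,q)` written out in coordinates. -/
lemma D3rel_three_iff {F : Type*} [CommRing F] (a b c : Fin 3 → F) :
    D3rel 3 F a b c ↔
      (a 1 + b 1 + c 1 + a 0 * b 0 + b 0 * c 0 + c 0 * a 0 = 0 ∧
        a 2 + b 2 + c 2 + a 0 * b 1 + b 0 * c 1 + c 0 * a 1 = 0) := by
  constructor
  · intro h
    have h1 := h 1 (by norm_num) (by norm_num)
    have h2 := h 2 (by norm_num) (by norm_num)
    simp only [ext, aIdx, bIdx] at h1 h2
    exact ⟨h1, h2⟩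
  · rintro ⟨h1, h2⟩ j hj hj3
    obtain rfl | rfl : j = 1 ∨ j = 2 := by omega
    · exact h1
    · exact h2

/-- The relation `D₃(3,q)` is invariant under cyclic rotation of its arguments. -/
lemma D3rel_three_rotate {F : Type*} [CommRing F] {a b c : Fin 3 → F}
    (h : D3rel 3 F a b c) : D3rel 3 F b c a := by
  rw [D3rel_three_iff] at h ⊢
  obtain ⟨h1, h2⟩ := h
  exact ⟨by linear_combination h1, by linear_combination h2⟩

lemma D3rel_three_of_D3edgeProp {F : Type*} [CommRing F] {p : Fin 3} {v u w : Fin 3 → F}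
    (h : D3edgeProp 3 F p v u w) : D3rel 3 F v u w := by
  unfold D3edgeProp at h
  split_ifs at h
  · exact h
  · exact D3rel_three_rotate h
  · exact D3rel_three_rotate (D3rel_three_rotate h)

/-- Two neighbours of `c` in the link of `a` with the same first coordinate coincide. -/
lemma D3rel_three_eq_left {F : Type*} [CommRing F] {a b b' c : Fin 3 → F}
    (h : D3rel 3 F a b c) (h' : D3rel 3 F a b' c) (h0 : b 0 = b' 0) : b = b' := by
  rw [D3rel_three_iff] at h h'
  obtain ⟨h1, h2⟩ := h
  obtain ⟨h1', h2'⟩ := h'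
  have e1 : b 1 = b' 1 := by linear_combination h1 - h1' - (a 0 + c 0) * h0
  have e2 : b 2 = b' 2 := by linear_combination h2 - h2' - a 0 * e1 - c 1 * h0
  funext i
  fin_cases i <;> assumption

/-- Two neighbours of `b` in the link of `a` with the same first coordinate coincide. -/
lemma D3rel_three_eq_right {F : Type*} [CommRing F] {a b c c' : Fin 3 → F}
    (h : D3rel 3 F a b c) (h' : D3rel 3 F a b c') (h0 : c 0 = c' 0) : c = c' := by
  rw [D3rel_three_iff] at h h'
  obtain ⟨h1, h2⟩ := h
  obtain ⟨h1', h2'⟩ := h'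
  have e1 : c 1 = c' 1 := by linear_combination h1 - h1' - (a 0 + b 0) * h0
  have e2 : c 2 = c' 2 := by linear_combination h2 - h2' - b 0 * e1 - a 1 * h0
  funext i
  fin_cases i <;> assumption

/-- There is no hexagon `b₁ c₁ b₂ c₂ b₃ c₃` in the link of `a`: the differences of the first
coordinates of the `cᵢ` solve a homogeneous Vandermonde system in the first coordinates of
the `bᵢ`. -/
lemma D3rel_three_no_hexagon {F : Type*} [Field F] {a b₁ b₂ b₃ c₁ c₂ c₃ : Fin 3 → F}
    (h₁₁ : D3rel 3 F a b₁ c₁) (h₂₁ : D3rel 3 F a b₂ c₁) (h₂₂ : D3rel 3 F a b₂ c₂)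
    (h₃₂ : D3rel 3 F a b₃ c₂) (h₃₃ : D3rel 3 F a b₃ c₃) (h₁₃ : D3rel 3 F a b₁ c₃)
    (hb₁₂ : b₁ ≠ b₂) (hb₁₃ : b₁ ≠ b₃) (hc₁₃ : c₁ ≠ c₃) : False := by
  have hx₁₂ : b₁ 0 - b₂ 0 ≠ 0 := fun h =>
    hb₁₂ (D3rel_three_eq_left h₁₁ h₂₁ (sub_eq_zero.1 h))
  have hx₁₃ : b₁ 0 - b₃ 0 ≠ 0 := fun h =>
    hb₁₃ (D3rel_three_eq_left h₁₃ h₃₃ (sub_eq_zero.1 h))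
  have hX : c₁ 0 - c₃ 0 ≠ 0 := fun h =>
    hc₁₃ (D3rel_three_eq_right h₁₁ h₁₃ (sub_eq_zero.1 h))
  rw [D3rel_three_iff] at h₁₁ h₂₁ h₂₂ h₃₂ h₃₃ h₁₃
  obtain ⟨p₁₁, r₁₁⟩ := h₁₁
  obtain ⟨p₂₁, r₂₁⟩ := h₂₁
  obtain ⟨p₂₂, r₂₂⟩ := h₂₂
  obtain ⟨p₃₂, r₃₂⟩ := h₃₂
  obtain ⟨p₃₃, r₃₃⟩ := h₃₃
  obtain ⟨p₁₃, r₁₃⟩ := h₁₃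
  have first : b₁ 0 * (c₁ 0 - c₃ 0) + b₂ 0 * (c₂ 0 - c₁ 0) + b₃ 0 * (c₃ 0 - c₂ 0) = 0 := by
    linear_combination p₁₁ - p₂₁ + p₂₂ - p₃₂ + p₃₃ - p₁₃
  have mixed : b₁ 0 * (c₁ 1 - c₃ 1) + b₂ 0 * (c₂ 1 - c₁ 1) + b₃ 0 * (c₃ 1 - c₂ 1) = 0 := by
    linear_combination r₁₁ - r₂₁ + r₂₂ - r₃₂ + r₃₃ - r₁₃
  have second : b₁ 0 ^ 2 * (c₁ 0 - c₃ 0) + b₂ 0 ^ 2 * (c₂ 0 - c₁ 0)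
      + b₃ 0 ^ 2 * (c₃ 0 - c₂ 0) = 0 := by
    linear_combination b₁ 0 * (p₁₁ - p₁₃) + b₂ 0 * (p₂₂ - p₂₁) + b₃ 0 * (p₃₃ - p₃₂)
      - mixed - a 0 * first
  have hprod : (b₁ 0 - b₂ 0) * (b₁ 0 - b₃ 0) * (c₁ 0 - c₃ 0) = 0 := by
    linear_combination second - (b₂ 0 + b₃ 0) * first
  exact mul_ne_zero (mul_ne_zero hx₁₂ hx₁₃) hX hprod

lemma linkD3_three_adj_inl {F : Type*} [CommRing F] {p : Fin 3} {v u : Fin 3 → F}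
    {y : (Fin 3 → F) ⊕ (Fin 3 → F)} (h : (linkD3 3 F p v).Adj (Sum.inl u) y) :
    ∃ w, y = Sum.inr w ∧ D3rel 3 F v u w := by
  obtain ⟨-, ⟨u', w, hu, hw, he⟩ | ⟨u', w, -, hw, -⟩⟩ := h
  · cases hu
    exact ⟨w, hw, D3rel_three_of_D3edgeProp he⟩
  · cases hw

lemma linkD3_three_adj_inr {F : Type*} [CommRing F] {p : Fin 3} {v w : Fin 3 → F}
    {y : (Fin 3 → F) ⊕ (Fin 3 → F)} (h : (linkD3 3 F p v).Adj (Sum.inr w) y) :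
    ∃ u, y = Sum.inl u ∧ D3rel 3 F v u w := by
  obtain ⟨-, ⟨u, w', hu, -, -⟩ | ⟨u, w', hu, hw, he⟩⟩ := h
  · cases hu
  · cases hw
    exact ⟨u, hu, D3rel_three_of_D3edgeProp he⟩

/-- A closed walk of length six starting in the left part of the link revisits a vertex. -/
lemma linkD3_three_no_hexagon {F : Type*} [Field F] {p : Fin 3} {v u : Fin 3 → F}
    {y₁ y₂ y₃ y₄ y₅ : (Fin 3 → F) ⊕ (Fin 3 → F)}
    (h₀₁ : (linkD3 3 F p v).Adj (Sum.inl u) y₁) (h₁₂ : (linkD3 3 F p v).Adj y₁ y₂)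
    (h₂₃ : (linkD3 3 F p v).Adj y₂ y₃) (h₃₄ : (linkD3 3 F p v).Adj y₃ y₄)
    (h₄₅ : (linkD3 3 F p v).Adj y₄ y₅) (h₅₀ : (linkD3 3 F p v).Adj y₅ (Sum.inl u))
    (n₀₂ : Sum.inl u ≠ y₂) (n₀₄ : Sum.inl u ≠ y₄) (n₁₅ : y₁ ≠ y₅) : False := by
  obtain ⟨c₁, rfl, e₁₁⟩ := linkD3_three_adj_inl h₀₁
  obtain ⟨b₂, rfl, e₂₁⟩ := linkD3_three_adj_inr h₁₂
  obtain ⟨c₂, rfl, e₂₂⟩ := linkD3_three_adj_inl h₂₃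
  obtain ⟨b₃, rfl, e₃₂⟩ := linkD3_three_adj_inr h₃₄
  obtain ⟨c₃, rfl, e₃₃⟩ := linkD3_three_adj_inl h₄₅
  obtain ⟨b₁, hb, e₁₃⟩ := linkD3_three_adj_inr h₅₀
  cases hb
  exact D3rel_three_no_hexagon e₁₁ e₂₁ e₂₂ e₃₂ e₃₃ e₁₃
    (ne_of_apply_ne _ n₀₂) (ne_of_apply_ne _ n₀₄) (ne_of_apply_ne _ n₁₅)

/-- For `q` a power of `3`, the 3-graph `D₃(3,q)` contains no copy of `C̃₆`:
the link of every vertex contains no cycle of length `6`. -/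
theorem D3_3_C6tilde_free (F : Type) [Field F] [Fintype F]
    (m : ℕ) (hm : 0 < m) (hcard : Fintype.card F = 3 ^ m) :
    ∀ (p : Fin 3) (v : Fin 3 → F),
      ¬ HasGraphCopy (SimpleGraph.cycleGraph 6) (linkD3 3 F p v) := by
  rintro p v ⟨f, hf⟩
  have adj (i : Fin 6) : (linkD3 3 F p v).Adj (f i) (f (i + 1)) :=
    hf _ _ (by revert i; simp [SimpleGraph.cycleGraph_adj])
  have ne {i j : Fin 6} (hij : i ≠ j) : f i ≠ f j := f.injective.ne hij
  have rot₂ : ∀ i : Fin 6, i ≠ i + 1 + 1 := by decide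
  have rot₄ : ∀ i : Fin 6, i ≠ i + 1 + 1 + 1 + 1 := by decide
  have rot₁₅ : ∀ i : Fin 6, i + 1 ≠ i + 1 + 1 + 1 + 1 + 1 := by decide
  have rot₆ : ∀ i : Fin 6, i + 1 + 1 + 1 + 1 + 1 + 1 = i := by decide
  have start (i : Fin 6) (u : Fin 3 → F) : f i ≠ Sum.inl u := by
    intro hu
    have h₀ := adj i
    have h₅ := adj (i + 1 + 1 + 1 + 1 + 1)
    have n₂ : f i ≠ f (i + 1 + 1) := ne (rot₂ i)
    have n₄ : f i ≠ f (i + 1 + 1 + 1 + 1) := ne (rot₄ i)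
    rw [rot₆ i] at h₅
    rw [hu] at h₀ h₅ n₂ n₄
    exact linkD3_three_no_hexagon h₀ (adj _) (adj _) (adj _) (adj _) h₅ n₂ n₄
      (ne (rot₁₅ i))
  rcases h : f 0 with u | w
  · exact start 0 u h
  · have h₀ := adj 0
    rw [h] at h₀
    obtain ⟨u, hu, -⟩ := linkD3_three_adj_inr h₀
    exact start _ u hu

end Paper
end

section
/- Let q be a power of 3 and let D_3(5,q) be the 3-partite 3-uniform hypergraph whose parts A, B, C are three disjoint copies of F_q^5, with coordinates written (x_1, x_{11}, x_{12}, x_{21}, x_{22}), where {a,b,c} with a ∈ A, b ∈ B, c ∈ C is a hyperedge if and only if a_{11}+b_{11}+c_{11}+a_1b_1+b_1c_1+c_1a_1 = 0, a_{12}+b_{12}+c_{12}+a_1b_{11}+b_1c_{11}+c_1a_{11} = 0, a_{21}+b_{21}+c_{21}+a_{11}b_1+b_{11}c_1+c_{11}a_1 = 0, and a_{22}+b_{22}+c_{22}+a_{12}b_1+b_{12}c_1+c_{12}a_1 = 0. Then D_3(5,q) contains no copy of C̃_8; that is, for every vertex x of D_3(5,q), the link of x contains no cycle of length 8. -/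
open scoped Classical

namespace Paper

theorem D3rel_five_iff {F : Type*} [CommRing F] (a b c : Fin 5 → F) :
    D3rel 5 F a b c ↔
      a 1 + b 1 + c 1 + a 0 * b 0 + b 0 * c 0 + c 0 * a 0 = 0 ∧
      a 2 + b 2 + c 2 + a 0 * b 1 + b 0 * c 1 + c 0 * a 1 = 0 ∧
      a 3 + b 3 + c 3 + a 1 * b 0 + b 1 * c 0 + c 1 * a 0 = 0 ∧
      a 4 + b 4 + c 4 + a 2 * b 0 + b 2 * c 0 + c 2 * a 0 = 0 := by
  constructor
  · intro h
    have h1 := h 1 (by norm_num) (by norm_num)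
    have h2 := h 2 (by norm_num) (by norm_num)
    have h3 := h 3 (by norm_num) (by norm_num)
    have h4 := h 4 (by norm_num) (by norm_num)
    simp [ext, aIdx, bIdx] at h1 h2 h3 h4
    exact ⟨h1, h2, h3, h4⟩
  · rintro ⟨h1, h2, h3, h4⟩ j hj hj5
    interval_cases j <;> simpa [ext, aIdx, bIdx]

theorem Drel_five_iff {F : Type*} [CommRing F] (a b : Fin 5 → F) :
    Drel 5 F a b ↔
      a 1 + b 1 + a 0 * b 0 = 0 ∧ a 2 + b 2 + a 0 * b 1 = 0 ∧
      a 3 + b 3 + a 1 * b 0 = 0 ∧ a 4 + b 4 + a 2 * b 0 = 0 := by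
  constructor
  · intro h
    have h1 := h 1 (by norm_num) (by norm_num)
    have h2 := h 2 (by norm_num) (by norm_num)
    have h3 := h 3 (by norm_num) (by norm_num)
    have h4 := h 4 (by norm_num) (by norm_num)
    simp [ext, aIdx, bIdx] at h1 h2 h3 h4
    exact ⟨h1, h2, h3, h4⟩
  · rintro ⟨h1, h2, h3, h4⟩ j hj hj5
    interval_cases j <;> simpa [ext, aIdx, bIdx]

theorem D3rel_rotate {k : ℕ} {F : Type*} [CommRing F] {a b c : Fin k → F}
    (h : D3rel k F a b c) : D3rel k F b c a := by
  intro j h1 hj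
  linear_combination h j h1 hj

theorem D3rel_of_D3edgeProp {k : ℕ} {F : Type*} [CommRing F] {p : Fin 3} {v u w : Fin k → F}
    (h : D3edgeProp k F p v u w) : D3rel k F v u w := by
  unfold D3edgeProp at h
  split_ifs at h
  · exact h
  · exact D3rel_rotate h
  · exact D3rel_rotate (D3rel_rotate h)

/-- In `D(5,q)` a neighbour of `b` is determined by its first coordinate. -/
theorem Drel_right_unique {F : Type*} [CommRing F] {b c c' : Fin 5 → F}
    (h : Drel 5 F b c) (h' : Drel 5 F b c') (h0 : c 0 = c' 0) : c = c' := by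
  rw [Drel_five_iff] at h h'
  obtain ⟨h1, h2, h3, h4⟩ := h
  obtain ⟨h1', h2', h3', h4'⟩ := h'
  have e1 : c 1 = c' 1 := by linear_combination h1 - h1' - b 0 * h0
  have e2 : c 2 = c' 2 := by linear_combination h2 - h2' - b 0 * e1
  have e3 : c 3 = c' 3 := by linear_combination h3 - h3' - b 1 * h0
  have e4 : c 4 = c' 4 := by linear_combination h4 - h4' - b 2 * h0
  ext i
  fin_cases i <;> assumption

theorem Drel_left_unique {F : Type*} [CommRing F] {b b' c : Fin 5 → F}
    (h : Drel 5 F b c) (h' : Drel 5 F b' c) (h0 : b 0 = b' 0) : b = b' := by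
  rw [Drel_five_iff] at h h'
  obtain ⟨h1, h2, h3, h4⟩ := h
  obtain ⟨h1', h2', h3', h4'⟩ := h'
  have e1 : b 1 = b' 1 := by linear_combination h1 - h1' - c 0 * h0
  have e2 : b 2 = b' 2 := by linear_combination h2 - h2' - c 1 * h0
  have e3 : b 3 = b' 3 := by linear_combination h3 - h3' - c 0 * e1
  have e4 : b 4 = b' 4 := by linear_combination h4 - h4' - c 0 * e2
  ext i
  fin_cases i <;> assumption

/-- Along a closed walk `b₁ c₁ b₂ c₂ b₃ c₃ b₄ c₄` in `D(5,q)`, a product of differences of first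
coordinates vanishes. -/
theorem Drel_closed_walk_eight {F : Type*} [CommRing F] {b₁ b₂ b₃ b₄ c₁ c₂ c₃ c₄ : Fin 5 → F}
    (h₁₁ : Drel 5 F b₁ c₁) (h₂₁ : Drel 5 F b₂ c₁) (h₂₂ : Drel 5 F b₂ c₂)
    (h₃₂ : Drel 5 F b₃ c₂) (h₃₃ : Drel 5 F b₃ c₃) (h₄₃ : Drel 5 F b₄ c₃)
    (h₄₄ : Drel 5 F b₄ c₄) (h₁₄ : Drel 5 F b₁ c₄) :
    (b₃ 0 - b₂ 0) * (b₂ 0 - b₁ 0) * (c₂ 0 - c₁ 0) * (c₃ 0 - c₂ 0) = 0 := by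
  rw [Drel_five_iff] at h₁₁ h₂₁ h₂₂ h₃₂ h₃₃ h₄₃ h₄₄ h₁₄
  obtain ⟨p1, p2, p3, p4⟩ := h₁₁
  obtain ⟨q1, q2, q3, q4⟩ := h₂₁
  obtain ⟨r1, r2, r3, r4⟩ := h₂₂
  obtain ⟨s1, s2, s3, s4⟩ := h₃₂
  obtain ⟨t1, t2, t3, t4⟩ := h₃₃
  obtain ⟨u1, u2, u3, u4⟩ := h₄₃
  obtain ⟨v1, v2, v3, v4⟩ := h₄₄
  obtain ⟨w1, w2, w3, w4⟩ := h₁₄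
  have E1 : b₁ 0 * (c₁ 0 - c₄ 0) + b₂ 0 * (c₂ 0 - c₁ 0) + b₃ 0 * (c₃ 0 - c₂ 0)
      + b₄ 0 * (c₄ 0 - c₃ 0) = 0 := by
    linear_combination p1 - q1 + r1 - s1 + t1 - u1 + v1 - w1
  have E3 : b₁ 1 * (c₁ 0 - c₄ 0) + b₂ 1 * (c₂ 0 - c₁ 0) + b₃ 1 * (c₃ 0 - c₂ 0)
      + b₄ 1 * (c₄ 0 - c₃ 0) = 0 := by
    linear_combination p3 - q3 + r3 - s3 + t3 - u3 + v3 - w3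
  have E4 : b₁ 2 * (c₁ 0 - c₄ 0) + b₂ 2 * (c₂ 0 - c₁ 0) + b₃ 2 * (c₃ 0 - c₂ 0)
      + b₄ 2 * (c₄ 0 - c₃ 0) = 0 := by
    linear_combination p4 - q4 + r4 - s4 + t4 - u4 + v4 - w4
  have y2 : c₂ 1 = c₁ 1 - b₂ 0 * (c₂ 0 - c₁ 0) := by linear_combination r1 - q1
  have y4 : c₄ 1 = c₁ 1 + b₁ 0 * (c₁ 0 - c₄ 0) := by linear_combination w1 - p1
  have x2 : b₂ 1 = b₁ 1 - (b₂ 0 - b₁ 0) * c₁ 0 := by linear_combination q1 - p1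
  have x3 : b₃ 1 = b₂ 1 - (b₃ 0 - b₂ 0) * c₂ 0 := by linear_combination s1 - r1
  have x4 : b₄ 1 = b₁ 1 + (b₁ 0 - b₄ 0) * c₄ 0 := by linear_combination v1 - w1
  have z2 : b₂ 2 = b₁ 2 - (b₂ 0 - b₁ 0) * c₁ 1 := by linear_combination q2 - p2
  have z3 : b₃ 2 = b₂ 2 - (b₃ 0 - b₂ 0) * c₂ 1 := by linear_combination s2 - r2
  have z4 : b₄ 2 = b₁ 2 + (b₁ 0 - b₄ 0) * c₄ 1 := by linear_combination v2 - w2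
  rw [x4, x3, x2] at E3
  rw [z4, z3, z2, y4, y2] at E4
  linear_combination E4 + b₁ 0 * E3 + (b₁ 0 * c₁ 0 + c₁ 1) * E1

/-- The coordinate change on the first part of the link of `a` in `D₃(5,q)` which, together with
`linkRightCoord`, identifies this link with `D(5,q)`. -/
def linkLeftCoord {F : Type*} [CommRing F] (a b : Fin 5 → F) : Fin 5 → F :=
  ![b 0 + a 0,
    b 1,
    b 2 + a 0 * b 1 - (b 0 + a 0) * (a 1 - a 0 ^ 2),
    b 3 - a 0 * b 1 + a 1 * b 0,
    b 4 - a 0 * b 2 + a 0 * (b 3 - a 0 * b 1 + a 1 * b 0) - (a 1 - a 0 ^ 2) * b 1 + a 2 * b 0]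

/-- The coordinate change on the second part of the link of `a` in `D₃(5,q)`. -/
def linkRightCoord {F : Type*} [CommRing F] (a c : Fin 5 → F) : Fin 5 → F :=
  ![c 0 + a 0,
    c 1 + a 1 - a 0 ^ 2,
    c 2 - a 0 * c 1 + a 1 * c 0 + a 2,
    c 3 + a 0 * c 1 + a 3,
    c 4 + a 0 * (c 3 + a 0 * c 1 + a 3) - (a 1 - a 0 ^ 2) * (c 1 + a 1 - a 0 ^ 2)
      + a 0 * c 2 + a 4]

theorem linkLeftCoord_injective {F : Type*} [CommRing F] (a : Fin 5 → F) :
    Function.Injective (linkLeftCoord a) := by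
  intro b b' h
  have h0 := congrFun h 0
  have h1 := congrFun h 1
  have h2 := congrFun h 2
  have h3 := congrFun h 3
  have h4 := congrFun h 4
  simp only [linkLeftCoord, Matrix.cons_val] at h0 h1 h2 h3 h4
  have e0 : b 0 = b' 0 := by linear_combination h0
  have e2 : b 2 = b' 2 := by
    linear_combination h2 - a 0 * h1 + (a 1 - a 0 ^ 2) * e0
  have e3 : b 3 = b' 3 := by linear_combination h3 + a 0 * h1 - a 1 * e0
  have e4 : b 4 = b' 4 := by
    linear_combination h4 + a 0 * e2 - a 0 * h3 + (a 1 - a 0 ^ 2) * h1 - a 2 * e0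
  ext i
  fin_cases i <;> assumption

theorem linkRightCoord_injective {F : Type*} [CommRing F] (a : Fin 5 → F) :
    Function.Injective (linkRightCoord a) := by
  intro c c' h
  have h0 := congrFun h 0
  have h1 := congrFun h 1
  have h2 := congrFun h 2
  have h3 := congrFun h 3
  have h4 := congrFun h 4
  simp only [linkRightCoord, Matrix.cons_val] at h0 h1 h2 h3 h4
  have e0 : c 0 = c' 0 := by linear_combination h0
  have e1 : c 1 = c' 1 := by linear_combination h1
  have e2 : c 2 = c' 2 := by linear_combination h2 + a 0 * e1 - a 1 * e0
  have e3 : c 3 = c' 3 := by linear_combination h3 - a 0 * e1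
  have e4 : c 4 = c' 4 := by
    linear_combination h4 - a 0 * h3 + (a 1 - a 0 ^ 2) * h1 - a 0 * e2
  ext i
  fin_cases i <;> assumption

theorem Drel_linkCoord {F : Type*} [CommRing F] {a b c : Fin 5 → F} (h : D3rel 5 F a b c) :
    Drel 5 F (linkLeftCoord a b) (linkRightCoord a c) := by
  rw [D3rel_five_iff] at h
  obtain ⟨h1, h2, h3, h4⟩ := h
  rw [Drel_five_iff]
  simp only [linkLeftCoord, linkRightCoord, Matrix.cons_val]
  refine ⟨?_, ?_, ?_, ?_⟩
  · linear_combination h1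
  · linear_combination h2
  · linear_combination h3
  · linear_combination h4 + a 0 * h3 - (a 1 - a 0 ^ 2) * h1

theorem D3rel_link_no_closed_walk_eight {F : Type*} [Field F]
    {a b₁ b₂ b₃ b₄ c₁ c₂ c₃ c₄ : Fin 5 → F}
    (h₁₁ : D3rel 5 F a b₁ c₁) (h₂₁ : D3rel 5 F a b₂ c₁) (h₂₂ : D3rel 5 F a b₂ c₂)
    (h₃₂ : D3rel 5 F a b₃ c₂) (h₃₃ : D3rel 5 F a b₃ c₃) (h₄₃ : D3rel 5 F a b₄ c₃)
    (h₄₄ : D3rel 5 F a b₄ c₄) (h₁₄ : D3rel 5 F a b₁ c₄)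
    (hb₁ : b₂ ≠ b₁) (hb₂ : b₃ ≠ b₂) (hc₁ : c₂ ≠ c₁) (hc₂ : c₃ ≠ c₂) : False := by
  replace h₁₁ := Drel_linkCoord h₁₁
  replace h₂₁ := Drel_linkCoord h₂₁
  replace h₂₂ := Drel_linkCoord h₂₂
  replace h₃₂ := Drel_linkCoord h₃₂
  replace h₃₃ := Drel_linkCoord h₃₃
  have key := Drel_closed_walk_eight h₁₁ h₂₁ h₂₂ h₃₂ h₃₃ (Drel_linkCoord h₄₃)
    (Drel_linkCoord h₄₄) (Drel_linkCoord h₁₄)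
  simp only [mul_eq_zero, sub_eq_zero] at key
  rcases key with ((h | h) | h) | h
  · exact hb₂ (linkLeftCoord_injective a (Drel_left_unique h₃₂ h₂₂ h))
  · exact hb₁ (linkLeftCoord_injective a (Drel_left_unique h₂₁ h₁₁ h))
  · exact hc₁ (linkRightCoord_injective a (Drel_right_unique h₂₂ h₂₁ h))
  · exact hc₂ (linkRightCoord_injective a (Drel_right_unique h₃₃ h₃₂ h))

theorem linkD3_adj_inl {k : ℕ} {F : Type*} [CommRing F] {p : Fin 3} {v u : Fin k → F}
    {y : (Fin k → F) ⊕ (Fin k → F)} (h : (linkD3 k F p v).Adj (Sum.inl u) y) :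
    ∃ w, y = Sum.inr w ∧ D3rel k F v u w := by
  rcases h with ⟨-, ⟨u', w, hu, hw, h⟩ | ⟨u', w, -, hw, -⟩⟩
  · cases hu
    exact ⟨w, hw, D3rel_of_D3edgeProp h⟩
  · cases hw

theorem linkD3_adj_inr {k : ℕ} {F : Type*} [CommRing F] {p : Fin 3} {v w : Fin k → F}
    {x : (Fin k → F) ⊕ (Fin k → F)} (h : (linkD3 k F p v).Adj (Sum.inr w) x) :
    ∃ u, x = Sum.inl u ∧ D3rel k F v u w := by
  rcases h with ⟨-, ⟨u, w', hu, -, -⟩ | ⟨u, w', hu, hw, h⟩⟩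
  · cases hu
  · cases hw
    exact ⟨u, hu, D3rel_of_D3edgeProp h⟩

theorem linkD3_no_eight_cycle_from_left {F : Type*} [Field F] {p : Fin 3} {v u : Fin 5 → F}
    {x₁ x₂ x₃ x₄ x₅ x₆ x₇ : (Fin 5 → F) ⊕ (Fin 5 → F)}
    (h₀ : (linkD3 5 F p v).Adj (Sum.inl u) x₁) (h₁ : (linkD3 5 F p v).Adj x₁ x₂)
    (h₂ : (linkD3 5 F p v).Adj x₂ x₃) (h₃ : (linkD3 5 F p v).Adj x₃ x₄)
    (h₄ : (linkD3 5 F p v).Adj x₄ x₅) (h₅ : (linkD3 5 F p v).Adj x₅ x₆)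
    (h₆ : (linkD3 5 F p v).Adj x₆ x₇) (h₇ : (linkD3 5 F p v).Adj x₇ (Sum.inl u))
    (n₀₂ : x₂ ≠ Sum.inl u) (n₂₄ : x₄ ≠ x₂) (n₁₃ : x₃ ≠ x₁) (n₃₅ : x₅ ≠ x₃) : False := by
  obtain ⟨c₁, rfl, e₀⟩ := linkD3_adj_inl h₀
  obtain ⟨b₂, rfl, e₁⟩ := linkD3_adj_inr h₁
  obtain ⟨c₂, rfl, e₂⟩ := linkD3_adj_inl h₂
  obtain ⟨b₃, rfl, e₃⟩ := linkD3_adj_inr h₃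
  obtain ⟨c₃, rfl, e₄⟩ := linkD3_adj_inl h₄
  obtain ⟨b₄, rfl, e₅⟩ := linkD3_adj_inr h₅
  obtain ⟨c₄, rfl, e₆⟩ := linkD3_adj_inl h₆
  obtain ⟨u', hu, e₇⟩ := linkD3_adj_inr h₇
  cases hu
  exact D3rel_link_no_closed_walk_eight e₀ e₁ e₂ e₃ e₄ e₅ e₆ e₇
    (fun h => n₀₂ (congrArg _ h)) (fun h => n₂₄ (congrArg _ h))
    (fun h => n₁₃ (congrArg _ h)) (fun h => n₃₅ (congrArg _ h))

/-- For `q` a power of `3`, the 3-graph `D₃(5,q)` contains no copy of `C̃₈`: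
the link of every vertex contains no cycle of length `8`. -/
theorem D3_5_C8tilde_free (F : Type) [Field F] [Fintype F]
    (m : ℕ) (hm : 0 < m) (hcard : Fintype.card F = 3 ^ m) :
    ∀ (p : Fin 3) (v : Fin 5 → F),
      ¬ HasGraphCopy (SimpleGraph.cycleGraph 8) (linkD3 5 F p v) := by
  rintro p v ⟨f, hf⟩
  have adj : ∀ i : Fin 8, (linkD3 5 F p v).Adj (f i) (f (i + 1)) := by
    intro i
    apply hf
    rw [SimpleGraph.cycleGraph_adj]
    exact Or.inr (add_sub_cancel_left i 1)
  have from_left : ∀ (i : Fin 8) (u : Fin 5 → F), f i ≠ Sum.inl u := by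
    intro i u hu
    have hne : ∀ i : Fin 8, i + 1 + 1 ≠ i := by decide
    have hcyc : ∀ i : Fin 8, i + 1 + 1 + 1 + 1 + 1 + 1 + 1 + 1 = i := by decide
    have h₀ := adj i
    have h₇ := adj (i + 1 + 1 + 1 + 1 + 1 + 1 + 1)
    have n₀ := f.injective.ne (hne i)
    rw [hcyc, hu] at h₇
    rw [hu] at h₀ n₀
    exact linkD3_no_eight_cycle_from_left h₀ (adj _) (adj _) (adj _) (adj _) (adj _) (adj _) h₇
      n₀ (f.injective.ne (hne _)) (f.injective.ne (hne _)) (f.injective.ne (hne _))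
  rcases h : f 0 with u | w
  · exact from_left 0 u h
  · have h₀ := adj 0
    rw [h] at h₀
    obtain ⟨u, hu, -⟩ := linkD3_adj_inr h₀
    exact from_left _ u hu

end Paper
end

section
/- There exist constants c_1, c_2 > 0 such that for all sufficiently large n: (i) there exists a 3-uniform hypergraph on n vertices with at least c_1 · n^{7/3} triples containing no copy of C̃_6, and (ii) every 3-uniform hypergraph on n vertices containing no copy of C̃_6 has at most c_2 · n^{7/3} triples. That is, ex_3(n, C̃_6) = Θ(n^{7/3}). -/
open scoped Classical

namespace Paper

/-- The relation `r` has a cycle of length six. -/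
def HasHexagon {V : Type*} (r : V → V → Prop) : Prop :=
  ∃ g : Fin 6 → V, Function.Injective g ∧ ∀ i, r (g i) (g (i + 1))

lemma HasHexagon.of_nodup {V : Type*} {r : V → V → Prop} {a b c d e f : V}
    (h : [a, b, c, d, e, f].Nodup) (hab : r a b) (hbc : r b c) (hcd : r c d) (hde : r d e)
    (hef : r e f) (hfa : r f a) : HasHexagon r := by
  refine ⟨fun i => [a, b, c, d, e, f].get i, h.injective_get, fun i => ?_⟩
  fin_cases i <;> assumption

lemma exists_mem_ne_of_three_lt_card {V : Type*} [DecidableEq V] {A : Finset V}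
    (hA : 3 < A.card) (a b c : V) : ∃ v ∈ A, v ≠ a ∧ v ≠ b ∧ v ≠ c := by
  obtain ⟨v, hv, hv'⟩ := Finset.exists_mem_notMem_of_card_lt_card
    (Finset.card_le_three.trans_lt hA : ({a, b, c} : Finset V).card < A.card)
  simp only [Finset.mem_insert, Finset.mem_singleton, not_or] at hv'
  exact ⟨v, hv, hv'⟩

/-- A relation between `S` and `T` with more than `3 (|S| + |T|)` incidences contains a path
`v₁ w₁ v₂ w₂ v₃` on five distinct vertices, with the `vᵢ` in `S` and the `wᵢ` in `T`. -/
lemma exists_path_of_lt_sum_card {V : Type*} [DecidableEq V] (r : V → V → Prop)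
    [DecidableRel r] (S T : Finset V)
    (h : 3 * (S.card + T.card) < ∑ v ∈ S, (T.filter (r v)).card) :
    ∃ v₁ ∈ S, ∃ v₂ ∈ S, ∃ v₃ ∈ S, ∃ w₁ ∈ T, ∃ w₂ ∈ T,
      r v₁ w₁ ∧ r v₂ w₁ ∧ r v₂ w₂ ∧ r v₃ w₂ ∧
      v₁ ≠ v₂ ∧ v₁ ≠ v₃ ∧ v₂ ≠ v₃ ∧ w₁ ≠ w₂ ∧ v₁ ≠ w₂ ∧ v₃ ≠ w₁ := by
  have hswap : ∀ S T : Finset V, ∑ v ∈ S, (T.filter (r v)).card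
      = ∑ w ∈ T, (S.filter (fun v => r v w)).card := fun S T =>
    Finset.sum_card_bipartiteAbove_eq_sum_card_bipartiteBelow r
  induction hk : S.card + T.card using Nat.strong_induction_on generalizing S T with
  | _ k ih =>
    by_cases hS : ∃ v ∈ S, (T.filter (r v)).card ≤ 3
    · obtain ⟨v, hv, hd⟩ := hS
      have hc := Finset.card_erase_add_one hv
      have hs := Finset.sum_erase_add S (fun v => (T.filter (r v)).card) hv
      obtain ⟨v₁, h₁, v₂, h₂, v₃, h₃, w₁, h₄, w₂, h₅, hr⟩ :=
        ih ((S.erase v).card + T.card) (by omega) (S.erase v) T (by omega) rfl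
      exact ⟨v₁, Finset.mem_of_mem_erase h₁, v₂, Finset.mem_of_mem_erase h₂, v₃,
        Finset.mem_of_mem_erase h₃, w₁, h₄, w₂, h₅, hr⟩
    by_cases hT : ∃ w ∈ T, (S.filter (fun v => r v w)).card ≤ 3
    · obtain ⟨w, hw, hd⟩ := hT
      have hc := Finset.card_erase_add_one hw
      have hs := Finset.sum_erase_add T (fun w => (S.filter (fun v => r v w)).card) hw
      have e₁ := hswap S T
      have e₂ := hswap S (T.erase w)
      obtain ⟨v₁, h₁, v₂, h₂, v₃, h₃, w₁, h₄, w₂, h₅, hr⟩ :=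
        ih (S.card + (T.erase w).card) (by omega) S (T.erase w) (by omega) rfl
      exact ⟨v₁, h₁, v₂, h₂, v₃, h₃, w₁, Finset.mem_of_mem_erase h₄, w₂,
        Finset.mem_of_mem_erase h₅, hr⟩
    push Not at hS hT
    obtain ⟨v₁, hv₁⟩ : S.Nonempty := by
      rw [Finset.nonempty_iff_ne_empty]
      rintro rfl
      simp at h
    obtain ⟨w₁, hw₁, -⟩ := exists_mem_ne_of_three_lt_card (hS v₁ hv₁) v₁ v₁ v₁
    rw [Finset.mem_filter] at hw₁
    obtain ⟨v₂, hv₂, h₂₁, -⟩ := exists_mem_ne_of_three_lt_card (hT w₁ hw₁.1) v₁ v₁ v₁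
    rw [Finset.mem_filter] at hv₂
    obtain ⟨w₂, hw₂, hw₂₁, hw₂v₁, -⟩ :=
      exists_mem_ne_of_three_lt_card (hS v₂ hv₂.1) w₁ v₁ v₁
    rw [Finset.mem_filter] at hw₂
    obtain ⟨v₃, hv₃, h₃₁, h₃₂, h₃w⟩ :=
      exists_mem_ne_of_three_lt_card (hT w₂ hw₂.1) v₁ v₂ w₁
    rw [Finset.mem_filter] at hv₃
    exact ⟨v₁, hv₁, v₂, hv₂.1, v₃, hv₃.1, w₁, hw₁.1, w₂, hw₂.1, hw₁.2, hv₂.2, hw₂.2, hv₃.2,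
      h₂₁.symm, h₃₁.symm, h₃₂.symm, hw₂₁.symm, hw₂v₁.symm, h₃w⟩

/-- In a hexagon-free relation, vertices with a common neighbour `x` span few incidences with
any set avoiding `x`. -/
lemma sum_card_le_of_common_neighbor {V : Type*} [DecidableEq V] {r : V → V → Prop}
    [DecidableRel r] (hsymm : ∀ u v, r u v → r v u) (hirr : ∀ v, ¬ r v v)
    (hfree : ¬ HasHexagon r) {x : V} {S T : Finset V} (hS : ∀ v ∈ S, r x v) (hT : x ∉ T) :
    ∑ v ∈ S, (T.filter (r v)).card ≤ 3 * (S.card + T.card) := by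
  by_contra! h
  obtain ⟨v₁, h₁, v₂, h₂, v₃, h₃, w₁, h₄, w₂, h₅, r₁, r₂, r₃, r₄, n₁, n₂, n₃, n₄, n₅, n₆⟩ :=
    exists_path_of_lt_sum_card r S T h
  refine hfree (HasHexagon.of_nodup (a := x) (b := v₁) (c := w₁) (d := v₂) (e := w₂) (f := v₃)
    ?_ (hS _ h₁) r₁ (hsymm _ _ r₂) r₃ (hsymm _ _ r₄) (hsymm _ _ (hS _ h₃)))
  have ne : ∀ {a b}, r a b → a ≠ b := by
    rintro a b hab rfl
    exact hirr _ hab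
  have := ne (hS _ h₁); have := ne (hS _ h₂); have := ne (hS _ h₃)
  have := ne r₁; have := ne r₂; have := ne r₃; have := ne r₄
  have : x ≠ w₁ := by rintro rfl; exact hT h₄
  have : x ≠ w₂ := by rintro rfl; exact hT h₅
  simp only [List.nodup_cons, List.mem_cons, List.not_mem_nil, or_false, not_or,
    List.nodup_nil, and_true, not_false_eq_true]
  grind

/-- In a hexagon-free relation, the vertices at distance two from `x` span few incidences with
any set avoiding `x` and its neighbours. -/
lemma sum_card_le_of_second_neighbor {V : Type*} [DecidableEq V] {r : V → V → Prop}
    [DecidableRel r] (hsymm : ∀ u v, r u v → r v u) (hirr : ∀ v, ¬ r v v)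
    (hfree : ¬ HasHexagon r) {x : V} {S T : Finset V}
    (hS : ∀ v ∈ S, v ≠ x ∧ ¬ r x v ∧ ∃ u, r x u ∧ r u v) (hT : ∀ w ∈ T, w ≠ x ∧ ¬ r x w) :
    ∑ v ∈ S, (T.filter (r v)).card ≤ 3 * (S.card + T.card) := by
  by_contra! h
  obtain ⟨v₁, h₁, v₂, h₂, v₃, h₃, w₁, h₄, w₂, h₅, r₁, r₂, r₃, r₄, n₁, n₂, n₃, n₄, n₅, n₆⟩ :=
    exists_path_of_lt_sum_card r S T h
  have ne : ∀ {a b}, r a b → a ≠ b := by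
    rintro a b hab rfl
    exact hirr _ hab
  have hpar : ∀ {v v' w u u'}, v ∈ S → v' ∈ S → w ∈ T → v ≠ v' → r v w → r v' w →
      r x u → r u v → r x u' → r u' v' → u = u' := by
    intro v v' w u u' hv hv' hw hvv hvw hvw' hu huv hu' huv'
    by_contra huu
    refine hfree (HasHexagon.of_nodup (a := x) (b := u) (c := v) (d := w) (e := v') (f := u')
      ?_ hu huv hvw (hsymm _ _ hvw') (hsymm _ _ huv') (hsymm _ _ hu'))
    have := ne hu; have := ne hu'; have := ne huv; have := ne huv'
    have := ne hvw; have := ne hvw'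
    have := hS v hv; have := hS v' hv'; have := hT w hw
    simp only [List.nodup_cons, List.mem_cons, List.not_mem_nil, or_false, not_or,
      List.nodup_nil, and_true, not_false_eq_true]
    grind
  obtain ⟨u₁, hu₁, hp₁⟩ := (hS _ h₁).2.2
  obtain ⟨u₂, hu₂, hp₂⟩ := (hS _ h₂).2.2
  obtain ⟨u₃, hu₃, hp₃⟩ := (hS _ h₃).2.2
  obtain rfl := hpar h₁ h₂ h₄ n₁ r₁ r₂ hu₁ hp₁ hu₂ hp₂
  obtain rfl := hpar h₂ h₃ h₅ n₃ r₃ r₄ hu₁ hp₂ hu₃ hp₃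
  refine hfree (HasHexagon.of_nodup (a := u₁) (b := v₁) (c := w₁) (d := v₂) (e := w₂) (f := v₃)
    ?_ hp₁ r₁ (hsymm _ _ r₂) r₃ (hsymm _ _ r₄) (hsymm _ _ hp₃))
  have := ne hp₁; have := ne hp₂; have := ne hp₃
  have := ne r₁; have := ne r₂; have := ne r₃; have := ne r₄
  have := hT _ h₄; have := hT _ h₅
  simp only [List.nodup_cons, List.mem_cons, List.not_mem_nil, or_false, not_or,
    List.nodup_nil, and_true, not_false_eq_true]
  grind

/-- A hexagon-free graph on at most `t³` vertices has a vertex of degree at most `12 + 3t`. -/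
lemma exists_card_filter_le {V : Type*} [DecidableEq V] {r : V → V → Prop}
    [DecidableRel r] (hsymm : ∀ u v, r u v → r v u) (hirr : ∀ v, ¬ r v v)
    (hfree : ¬ HasHexagon r) {W : Finset V} (hW : W.Nonempty) {t : ℝ} (ht : 1 ≤ t)
    (hcard : (W.card : ℝ) ≤ t ^ 3) :
    ∃ v ∈ W, ((W.filter (r v)).card : ℝ) ≤ 12 + 3 * t := by
  by_contra! hdeg
  obtain ⟨x, hx⟩ := hW
  set A := W.filter (r x) with hA
  set B := W.filter (fun v => v ≠ x ∧ ¬ r x v ∧ ∃ u ∈ A, r u v) with hB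
  set C := W.filter (fun v => v ≠ x ∧ ¬ r x v ∧ ¬ ∃ u ∈ A, r u v) with hC
  have hAB : ∑ u ∈ A, ((A ∪ B).filter (r u)).card ≤ 3 * (A.card + (A ∪ B).card) :=
    sum_card_le_of_common_neighbor hsymm hirr hfree (x := x) (by simp [hA])
      (by simp [hA, hB, hirr])
  have hBA : ∑ u ∈ A, (B.filter (r u)).card ≤ 3 * (A.card + B.card) :=
    sum_card_le_of_common_neighbor hsymm hirr hfree (x := x) (by simp [hA]) (by simp [hB])
  have hBC : ∑ v ∈ B, ((B ∪ C).filter (r v)).card ≤ 3 * (B.card + (B ∪ C).card) := by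
    refine sum_card_le_of_second_neighbor hsymm hirr hfree (x := x) ?_ ?_
    · grind
    · grind
  have hswap : ∑ v ∈ B, (A.filter (r v)).card = ∑ u ∈ A, (B.filter (r u)).card := by
    refine (Finset.sum_card_bipartiteAbove_eq_sum_card_bipartiteBelow r).trans
      (Finset.sum_congr rfl fun u _ => congrArg Finset.card (Finset.filter_congr fun v _ => ?_))
    exact ⟨hsymm v u, hsymm u v⟩
  have hdA : ∀ u ∈ A, (W.filter (r u)).card ≤ 1 + ((A ∪ B).filter (r u)).card := by
    intro u hu
    rw [add_comm]
    refine (Finset.card_le_card ?_).trans (Finset.card_insert_le x _)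
    intro w hw
    grind
  have hdB : ∀ v ∈ B, (W.filter (r v)).card
      ≤ (A.filter (r v)).card + ((B ∪ C).filter (r v)).card := by
    intro v hv
    refine (Finset.card_le_card ?_).trans (Finset.card_union_le _ _)
    intro w hw
    grind
  have hsA : (12 + 3 * t) * A.card ≤ ∑ u ∈ A, ((W.filter (r u)).card : ℝ) := by
    rw [mul_comm, ← nsmul_eq_mul]
    exact Finset.card_nsmul_le_sum _ _ _ fun u hu => (hdeg u (Finset.mem_filter.1 hu).1).le
  have hsB : (12 + 3 * t) * B.card ≤ ∑ v ∈ B, ((W.filter (r v)).card : ℝ) := by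
    rw [mul_comm, ← nsmul_eq_mul]
    exact Finset.card_nsmul_le_sum _ _ _ fun u hu => (hdeg u (Finset.mem_filter.1 hu).1).le
  have hA' := Finset.sum_le_sum hdA
  have hB' := Finset.sum_le_sum hdB
  rw [Finset.sum_add_distrib] at hA' hB'
  rw [Finset.sum_const, smul_eq_mul, mul_one] at hA'
  have u₁ := Finset.card_union_le A B
  have u₂ := Finset.card_union_le B C
  have i₁ : ∑ u ∈ A, (W.filter (r u)).card ≤ 7 * A.card + 3 * B.card := by omega
  have i₂ : ∑ v ∈ B, (W.filter (r v)).card ≤ 3 * A.card + 9 * B.card + 3 * C.card := by omega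
  have j₁ : ∑ u ∈ A, ((W.filter (r u)).card : ℝ) ≤ 7 * A.card + 3 * B.card := by
    exact_mod_cast i₁
  have j₂ : ∑ v ∈ B, ((W.filter (r v)).card : ℝ) ≤ 3 * A.card + 9 * B.card + 3 * C.card := by
    exact_mod_cast i₂
  have k₁ : (12 + 3 * t) < (A.card : ℝ) := hdeg x hx
  have k₂ : (C.card : ℝ) ≤ t ^ 3 :=
    le_trans (by exact_mod_cast Finset.card_filter_le _ _) hcard
  have l₁ : t * A.card ≤ B.card := by nlinarith
  have l₂ : (A.card : ℝ) ≤ B.card := by nlinarith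
  have l₃ : t * B.card ≤ C.card := by nlinarith
  have l₄ : t * (t * A.card) ≤ t * B.card := by gcongr
  have l₅ : t * (t * (12 + 3 * t)) ≤ t * (t * A.card) := by gcongr
  nlinarith [sq_nonneg t]

/-- A hexagon-free graph on at most `t³` vertices has at most `12 + 3t` edges per vertex. -/
lemma sum_card_filter_le {V : Type*} [DecidableEq V] {r : V → V → Prop}
    [DecidableRel r] (hsymm : ∀ u v, r u v → r v u) (hirr : ∀ v, ¬ r v v)
    (hfree : ¬ HasHexagon r) {t : ℝ} (ht : 1 ≤ t) (W : Finset V) (hcard : (W.card : ℝ) ≤ t ^ 3) :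
    ∑ v ∈ W, ((W.filter (r v)).card : ℝ) ≤ 2 * (12 + 3 * t) * W.card := by
  induction W using Finset.strongInduction with
  | _ W ih =>
    obtain rfl | hW := W.eq_empty_or_nonempty
    · simp
    obtain ⟨v, hv, hd⟩ := exists_card_filter_le hsymm hirr hfree hW ht hcard
    have hc := Finset.card_erase_add_one hv
    have hc' : ((W.erase v).card : ℝ) + 1 = W.card := by exact_mod_cast hc
    have h := ih (W.erase v) (Finset.erase_ssubset hv) (by linarith)
    have hs := Finset.sum_erase_add W (fun v => ((W.filter (r v)).card : ℝ)) hv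
    have hstep : ∑ u ∈ W.erase v, (W.filter (r u)).card ≤
        ∑ u ∈ W.erase v, ((W.erase v).filter (r u)).card + (W.filter (r v)).card := by
      have hdeg : (W.filter (r v)).card = ∑ u ∈ W.erase v, if r u v then 1 else 0 := by
        rw [← Finset.card_filter]
        congr 1
        grind
      rw [hdeg, ← Finset.sum_add_distrib]
      refine Finset.sum_le_sum fun u _ => ?_
      split_ifs with huv
      · refine (Finset.card_le_card ?_).trans (Finset.card_insert_le v _)
        grind
      · refine Finset.card_le_card ?_
        grind
    have hstep' : ∑ u ∈ W.erase v, ((W.filter (r u)).card : ℝ) ≤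
        ∑ u ∈ W.erase v, (((W.erase v).filter (r u)).card : ℝ) + (W.filter (r v)).card := by
      exact_mod_cast hstep
    rw [← hs, ← hc']
    linarith

lemma hasHypCopy_hypSuspension_cycleGraph_six_iff {V : Type*} [DecidableEq V]
    {H : Set (Finset V)} :
    HasHypCopy (hypSuspension (SimpleGraph.cycleGraph 6)) H ↔
      ∃ (x : V) (g : Fin 6 → V), Function.Injective g ∧ (∀ i, g i ≠ x) ∧
        ∀ i, ({x, g i, g (i + 1)} : Finset V) ∈ H := by
  constructor
  · rintro ⟨f, hf⟩
    refine ⟨f none, fun i => f (some i), fun i j h => by simpa using h, fun i => by simp,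
      fun i => ?_⟩
    have := hf _ ⟨i, i + 1, by simp [SimpleGraph.cycleGraph_adj], rfl⟩
    convert this using 1
    ext
    simp
  · rintro ⟨x, g, hg, hx, h⟩
    refine ⟨⟨fun o => o.elim x g, ?_⟩, ?_⟩
    · rintro (_ | i) (_ | j) hij
      · rfl
      · exact (hx j hij.symm).elim
      · exact (hx i hij).elim
      · exact congrArg some (hg hij)
    · rintro _ ⟨u, v, huv, rfl⟩
      rw [SimpleGraph.cycleGraph_adj] at huv
      obtain huv | huv := huv
      · obtain rfl : u = v + 1 := sub_eq_iff_eq_add'.1 huv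
        convert h v using 1
        ext
        simp only [Finset.mem_map, Finset.mem_insert, Finset.mem_singleton, exists_eq_or_imp,
          exists_eq_left, Function.Embedding.coeFn_mk, Option.elim]
        grind
      · obtain rfl : v = u + 1 := sub_eq_iff_eq_add'.1 huv
        convert h u using 1
        ext
        simp only [Finset.mem_map, Finset.mem_insert, Finset.mem_singleton, exists_eq_or_imp,
          exists_eq_left, Function.Embedding.coeFn_mk, Option.elim]
        grind

/-- A `C̃₆`-free 3-graph on `n ≤ t³` vertices has at most `2 (12 + 3t) n²` triples. -/
lemma card_le_of_not_hasHypCopy {V : Type*} [DecidableEq V] [Fintype V] {H : Finset (Finset V)}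
    (h3 : ∀ e ∈ H, e.card = 3)
    (hfree : ¬ HasHypCopy (hypSuspension (SimpleGraph.cycleGraph 6)) (H : Set (Finset V)))
    {t : ℝ} (ht : 1 ≤ t) (hcard : (Fintype.card V : ℝ) ≤ t ^ 3) :
    (H.card : ℝ) ≤ 2 * (12 + 3 * t) * Fintype.card V ^ 2 := by
  let r : V → V → V → Prop := fun x u v => u ≠ x ∧ v ≠ x ∧ u ≠ v ∧ ({x, u, v} : Finset V) ∈ H
  have hlink : ∀ x, ∑ u, ((Finset.univ.filter (r x u)).card : ℝ)
      ≤ 2 * (12 + 3 * t) * Fintype.card V := by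
    intro x
    refine sum_card_filter_le ?_ ?_ ?_ ht Finset.univ hcard
    · rintro u v ⟨h₁, h₂, h₃, h₄⟩
      exact ⟨h₂, h₁, h₃.symm, by rwa [Finset.pair_comm v u]⟩
    · rintro v ⟨-, -, h, -⟩
      exact h rfl
    · rintro ⟨g, hg, h⟩
      exact hfree (hasHypCopy_hypSuspension_cycleGraph_six_iff.2
        ⟨x, g, hg, fun i => (h i).1, fun i => (h i).2.2.2⟩)
  have hsub : H ⊆ (Finset.univ.filter (fun p : V × V × V => r p.1 p.2.1 p.2.2)).image
      (fun p => {p.1, p.2.1, p.2.2}) := by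
    intro e he
    obtain ⟨x, u, v, h₁, h₂, h₃, rfl⟩ := Finset.card_eq_three.1 (h3 e he)
    exact Finset.mem_image.2 ⟨(x, u, v), by simp [r, *, Ne.symm], rfl⟩
  have hle := (Finset.card_le_card hsub).trans Finset.card_image_le
  have hcount : (Finset.univ.filter (fun p : V × V × V => r p.1 p.2.1 p.2.2)).card
      = ∑ x, ∑ u, (Finset.univ.filter (r x u)).card := by
    simp only [Finset.card_filter, Fintype.sum_prod_type]
  rw [hcount] at hle
  calc (H.card : ℝ) ≤ ∑ x, ∑ u, ((Finset.univ.filter (r x u)).card : ℝ) := by exact_mod_cast hle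
    _ ≤ ∑ _x : V, 2 * (12 + 3 * t) * Fintype.card V := Finset.sum_le_sum fun x _ => hlink x
    _ = 2 * (12 + 3 * t) * Fintype.card V ^ 2 := by
      rw [Finset.sum_const, nsmul_eq_mul, Finset.card_univ]; ring

/-- The cyclically symmetric incidence relation of the 3-graph `D₃(3, q)`. -/
def TripleRel {F : Type*} [Ring F] (a b c : F × F × F) : Prop :=
  a.2.1 + b.2.1 + c.2.1 + a.1 * b.1 + b.1 * c.1 + c.1 * a.1 = 0 ∧
    a.2.2 + b.2.2 + c.2.2 + a.1 * b.2.1 + b.1 * c.2.1 + c.1 * a.2.1 = 0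

lemma TripleRel.rotate {F : Type*} [Ring F] {a b c : F × F × F} (h : TripleRel a b c) :
    TripleRel b c a := by
  refine ⟨?_, ?_⟩
  · rw [← h.1]; abel
  · rw [← h.2]; abel

lemma TripleRel.eq_third {F : Type*} [Ring F] {a b c c' : F × F × F} (h : TripleRel a b c)
    (h' : TripleRel a b c') (hc : c.1 = c'.1) : c = c' := by
  obtain ⟨h₁, h₂⟩ := h
  obtain ⟨h₁', h₂'⟩ := h'
  have e : c.2.1 = c'.2.1 := by
    rw [hc] at h₁
    have := h₁.trans h₁'.symm
    simpa using this
  have e' : c.2.2 = c'.2.2 := by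
    rw [hc, e] at h₂
    have := h₂.trans h₂'.symm
    simpa using this
  exact Prod.ext hc (Prod.ext e e')

lemma TripleRel.eq_second {F : Type*} [Ring F] {a b b' c : F × F × F} (h : TripleRel a b c)
    (h' : TripleRel a b' c) (hb : b.1 = b'.1) : b = b' :=
  h.rotate.rotate.eq_third h'.rotate.rotate hb

/-- The links of `D₃(3, q)` have no cycle of length six. -/
lemma TripleRel.not_hexagon {F : Type*} [Field F] {c u₁ u₂ u₃ w₁ w₂ w₃ : F × F × F}
    (hu₁₂ : u₁ ≠ u₂) (hu₁₃ : u₁ ≠ u₃) (hw₁₃ : w₁ ≠ w₃)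
    (h₁ : TripleRel c u₁ w₁) (h₂ : TripleRel c u₂ w₁) (h₃ : TripleRel c u₂ w₂)
    (h₄ : TripleRel c u₃ w₂) (h₅ : TripleRel c u₃ w₃) (h₆ : TripleRel c u₁ w₃) : False := by
  have d₁ : u₁.1 - u₂.1 ≠ 0 := fun h => hu₁₂ (h₁.eq_second h₂ (sub_eq_zero.1 h))
  have d₂ : u₁.1 - u₃.1 ≠ 0 := fun h => hu₁₃ (h₆.eq_second h₅ (sub_eq_zero.1 h))
  have d₃ : w₁.1 - w₃.1 ≠ 0 := fun h => hw₁₃ (h₁.eq_third h₆ (sub_eq_zero.1 h))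
  obtain ⟨p₁, q₁⟩ := h₁
  obtain ⟨p₂, q₂⟩ := h₂
  obtain ⟨p₃, q₃⟩ := h₃
  obtain ⟨p₄, q₄⟩ := h₄
  obtain ⟨p₅, q₅⟩ := h₅
  obtain ⟨p₆, q₆⟩ := h₆
  have a₁ : (u₁.1 - u₂.1) * (w₁.1 - w₃.1) + (u₂.1 - u₃.1) * (w₂.1 - w₃.1) = 0 := by
    linear_combination p₁ - p₂ + p₃ - p₄ + p₅ - p₆
  have a₂ : (u₁.1 - u₂.1) * (w₁.2.1 - w₃.2.1) + (u₂.1 - u₃.1) * (w₂.2.1 - w₃.2.1) = 0 := by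
    linear_combination q₁ - q₂ + q₃ - q₄ + q₅ - q₆
  have a₃ : w₁.2.1 - w₃.2.1 = -(u₁.1 + c.1) * (w₁.1 - w₃.1) := by
    linear_combination p₁ - p₆
  have a₄ : w₂.2.1 - w₃.2.1 = -(u₃.1 + c.1) * (w₂.1 - w₃.1) := by
    linear_combination p₄ - p₅
  rw [a₃, a₄] at a₂
  have : (u₁.1 - u₂.1) * (u₁.1 - u₃.1) * (w₁.1 - w₃.1) = 0 := by
    linear_combination -a₂ - (u₃.1 + c.1) * a₁
  simp_all

/-- A copy of `D₃(3, q)` on the vertices `φ (i, a)`, where `i` is the index of a part. -/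
noncomputable def tripleHypergraph {F V : Type*} [Ring F] [Fintype F]
    [Fintype V] (φ : Fin 3 × (F × F × F) ↪ V) : Finset (Finset V) :=
  Finset.univ.filter fun e => ∃ a b c, TripleRel a b c ∧ e = {φ (0, a), φ (1, b), φ (2, c)}

lemma exists_of_mem_tripleHypergraph {F V : Type*} [Ring F] [Fintype F]
    [Fintype V] {φ : Fin 3 × (F × F × F) ↪ V} {x u v : V} (hux : u ≠ x) (hvx : v ≠ x)
    (huv : u ≠ v) (h : {x, u, v} ∈ tripleHypergraph φ) :
    ∃ i a b c, TripleRel c a b ∧ x = φ (i, c) ∧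
      (u = φ (i + 1, a) ∧ v = φ (i + 2, b) ∨ u = φ (i + 2, b) ∧ v = φ (i + 1, a)) := by
  obtain ⟨a, b, c, hr, he⟩ := (Finset.mem_filter.1 h).2
  have hx : x ∈ ({φ (0, a), φ (1, b), φ (2, c)} : Finset V) := he ▸ by simp
  have hu : u ∈ ({φ (0, a), φ (1, b), φ (2, c)} : Finset V) := he ▸ by simp
  have hv : v ∈ ({φ (0, a), φ (1, b), φ (2, c)} : Finset V) := he ▸ by simp
  simp only [Finset.mem_insert, Finset.mem_singleton] at hx hu hv
  obtain rfl | rfl | rfl := hx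
  · exact ⟨0, b, c, a, hr, rfl, by grind⟩
  · exact ⟨1, c, a, b, hr.rotate, rfl, by grind⟩
  · exact ⟨2, a, b, c, hr.rotate.rotate, rfl, by grind⟩

lemma not_hasHypCopy_tripleHypergraph {F V : Type*} [Field F] [Fintype F]
    [Fintype V] (φ : Fin 3 × (F × F × F) ↪ V) :
    ¬ HasHypCopy (hypSuspension (SimpleGraph.cycleGraph 6))
      (tripleHypergraph φ : Set (Finset V)) := by
  rw [hasHypCopy_hypSuspension_cycleGraph_six_iff]
  rintro ⟨x, g, hg, hx, h⟩
  have hstep : ∀ i, ∃ j a b c, TripleRel c a b ∧ x = φ (j, c) ∧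
      (g i = φ (j + 1, a) ∧ g (i + 1) = φ (j + 2, b) ∨
        g i = φ (j + 2, b) ∧ g (i + 1) = φ (j + 1, a)) := fun i =>
    exists_of_mem_tripleHypergraph (hx i) (hx _) (hg.ne (by simp)) (h i)
  obtain ⟨j, -, -, c, -, rfl, -⟩ := hstep 0
  have hfwd : ∀ {i a}, g i = φ (j + 1, a) → ∃ b, g (i + 1) = φ (j + 2, b) ∧ TripleRel c a b := by
    intro i a hi
    obtain ⟨j', a', b', c', hr, hc, h⟩ := hstep i
    simp only [hi, φ.injective.eq_iff, Prod.mk.injEq] at hc h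
    obtain ⟨rfl, rfl⟩ := hc
    obtain ⟨⟨-, rfl⟩, h⟩ | ⟨⟨h, -⟩, -⟩ := h
    · exact ⟨b', h, hr⟩
    · simp at h
  have hbwd : ∀ {i b}, g i = φ (j + 2, b) → ∃ a, g (i + 1) = φ (j + 1, a) ∧ TripleRel c a b := by
    intro i b hi
    obtain ⟨j', a', b', c', hr, hc, h⟩ := hstep i
    simp only [hi, φ.injective.eq_iff, Prod.mk.injEq] at hc h
    obtain ⟨rfl, rfl⟩ := hc
    obtain ⟨⟨h, -⟩, -⟩ | ⟨⟨-, rfl⟩, h⟩ := h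
    · simp at h
    · exact ⟨a', h, hr⟩
  have hno : ∀ {i a}, g i ≠ φ (j + 1, a) := by
    intro i u₁ e₀
    obtain ⟨w₁, e₁, r₁⟩ := hfwd e₀
    obtain ⟨u₂, e₂, r₂⟩ := hbwd e₁
    obtain ⟨w₂, e₃, r₃⟩ := hfwd e₂
    obtain ⟨u₃, e₄, r₄⟩ := hbwd e₃
    obtain ⟨w₃, e₅, r₅⟩ := hfwd e₄
    obtain ⟨u₁', e₆, r₆⟩ := hbwd e₅
    have hi : ∀ i : Fin 6, i + 1 + 1 + 1 + 1 + 1 + 1 = i ∧ i ≠ i + 1 + 1 ∧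
        i ≠ i + 1 + 1 + 1 + 1 := by decide
    rw [(hi i).1, e₀, φ.injective.eq_iff, Prod.mk.injEq] at e₆
    obtain rfl := e₆.2
    refine TripleRel.not_hexagon ?_ ?_ ?_ r₁ r₂ r₃ r₄ r₅ r₆
    · rintro rfl
      exact (hi i).2.1 (hg (e₀.trans e₂.symm))
    · rintro rfl
      exact (hi i).2.2 (hg (e₀.trans e₄.symm))
    · rintro rfl
      exact (hi (i + 1)).2.2 (hg (e₁.trans e₅.symm))
  obtain ⟨j', a', b', c', hr, hc, h⟩ := hstep 0
  obtain ⟨rfl, rfl⟩ := Prod.mk.injEq .. ▸ φ.injective hc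
  obtain ⟨h, -⟩ | ⟨-, h⟩ := h
  · exact hno h
  · exact hno h

lemma card_eq_three_of_mem_tripleHypergraph {F V : Type*} [Ring F] [Fintype F]
    [Fintype V] (φ : Fin 3 × (F × F × F) ↪ V) {e : Finset V} (he : e ∈ tripleHypergraph φ) :
    e.card = 3 := by
  obtain ⟨a, b, c, -, rfl⟩ := (Finset.mem_filter.1 he).2
  rw [Finset.card_eq_three]
  exact ⟨_, _, _, by simp, by simp, by simp, rfl⟩

lemma card_pow_seven_le_card_tripleHypergraph {F V : Type*} [Ring F] [Fintype F]
    [Fintype V] (φ : Fin 3 × (F × F × F) ↪ V) :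
    Fintype.card F ^ 7 ≤ (tripleHypergraph φ).card := by
  let third : F × (F × F × F) × (F × F × F) → F × F × F := fun ⟨z, a, b⟩ =>
    (z, -(a.2.1 + b.2.1 + a.1 * b.1 + b.1 * z + z * a.1),
      -(a.2.2 + b.2.2 + a.1 * b.2.1
        + b.1 * -(a.2.1 + b.2.1 + a.1 * b.1 + b.1 * z + z * a.1) + z * a.2.1))
  have hcard : Fintype.card F ^ 7 =
      (Finset.univ : Finset (F × (F × F × F) × (F × F × F))).card := by
    simp only [Finset.card_univ, Fintype.card_prod]
    ring
  rw [hcard]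
  refine Finset.card_le_card_of_injOn
    (fun p => {φ (0, p.2.1), φ (1, p.2.2), φ (2, third p)}) ?_ ?_
  · rintro ⟨z, a, b⟩ -
    refine Finset.mem_filter.2 ⟨Finset.mem_univ _, a, b, third (z, a, b), ⟨?_, ?_⟩, rfl⟩
    · simp only [third]; abel
    · simp only [third]; abel
  · rintro ⟨z, a, b⟩ - ⟨z', a', b'⟩ - h
    have key : ∀ p, p ∈ ({φ (0, a), φ (1, b), φ (2, third (z, a, b))} : Finset V) →
        p ∈ ({φ (0, a'), φ (1, b'), φ (2, third (z', a', b'))} : Finset V) :=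
      fun p hp => (Finset.ext_iff.1 h p).1 hp
    have h₀ := key (φ (0, a)) (by simp)
    have h₁ := key (φ (1, b)) (by simp)
    have h₂ := key (φ (2, third (z, a, b))) (by simp)
    simp [φ.injective.eq_iff] at h₀ h₁ h₂
    obtain rfl := h₀
    obtain rfl := h₁
    exact congrArg (fun z => (z, a, b)) (congrArg Prod.fst h₂)

/-- Every `n ≥ 24` admits a prime `p` with `3 p³ ≤ n ≤ 192 p³`. -/
lemma exists_prime_pow_three_near {n : ℕ} (hn : 24 ≤ n) :
    ∃ p, p.Prime ∧ 3 * p ^ 3 ≤ n ∧ n ≤ 192 * p ^ 3 := by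
  let m := Nat.findGreatest (fun m => 24 * m ^ 3 ≤ n) n
  have hm : 24 * m ^ 3 ≤ n :=
    Nat.findGreatest_spec (P := fun m => 24 * m ^ 3 ≤ n) (m := 1) (by omega) (by omega)
  have hm1 : 1 ≤ m := Nat.le_findGreatest (by omega) (by omega)
  have hlt : n < 24 * (m + 1) ^ 3 := by
    by_contra! h
    have : m + 1 ≤ n := by nlinarith [Nat.le_self_pow (three_ne_zero) (m + 1)]
    exact absurd (Nat.le_findGreatest (P := fun m => 24 * m ^ 3 ≤ n) this h)
      (Nat.not_succ_le_self m)
  obtain ⟨p, hp, hmp, hpm⟩ := Nat.exists_prime_lt_and_le_two_mul m (by omega)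
  refine ⟨p, hp, ?_, ?_⟩
  · have := Nat.pow_le_pow_left hpm 3
    rw [mul_pow] at this
    omega
  · have := Nat.pow_le_pow_left hmp 3
    rw [Nat.succ_eq_add_one] at this
    omega

/-- `ex₃(n, C̃₆) = Θ(n^{7/3})`: there are constants `c₁, c₂ > 0` such that for
all large `n`, some `C̃₆`-free 3-graph on `n` vertices has at least `c₁ n^{7/3}` triples, and
every `C̃₆`-free 3-graph on `n` vertices has at most `c₂ n^{7/3}` triples. -/
theorem ex3_C6tilde_theta :
    ∃ c₁ c₂ : ℝ, 0 < c₁ ∧ 0 < c₂ ∧ ∃ N : ℕ, ∀ n : ℕ, N ≤ n →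
      (∃ H : Finset (Finset (Fin n)), (∀ e ∈ H, e.card = 3) ∧
        ¬ HasHypCopy (hypSuspension (SimpleGraph.cycleGraph 6))
            (↑H : Set (Finset (Fin n))) ∧
        c₁ * (n : ℝ) ^ ((7 : ℝ) / 3) ≤ (H.card : ℝ)) ∧
      (∀ H : Finset (Finset (Fin n)), (∀ e ∈ H, e.card = 3) →
        ¬ HasHypCopy (hypSuspension (SimpleGraph.cycleGraph 6))
            (↑H : Set (Finset (Fin n))) →
        (H.card : ℝ) ≤ c₂ * (n : ℝ) ^ ((7 : ℝ) / 3)) := by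
  refine ⟨(192 : ℝ) ^ (-(7 / 3) : ℝ), 30, by positivity, by norm_num, 24, fun n hn => ⟨?_, ?_⟩⟩
  · obtain ⟨p, hp, h₁, h₂⟩ := exists_prime_pow_three_near hn
    have : Fact p.Prime := ⟨hp⟩
    obtain ⟨φ⟩ : Nonempty (Fin 3 × (ZMod p × ZMod p × ZMod p) ↪ Fin n) := by
      refine Function.Embedding.nonempty_of_card_le ?_
      simp only [Fintype.card_prod, ZMod.card, Fintype.card_fin]
      linarith
    refine ⟨tripleHypergraph φ, fun e he => card_eq_three_of_mem_tripleHypergraph φ he,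
      not_hasHypCopy_tripleHypergraph φ, ?_⟩
    have hcard := card_pow_seven_le_card_tripleHypergraph φ
    rw [ZMod.card] at hcard
    have h₂' : (n : ℝ) ≤ 192 * (p : ℝ) ^ 3 := by exact_mod_cast h₂
    calc (192 : ℝ) ^ (-(7 / 3) : ℝ) * (n : ℝ) ^ ((7 : ℝ) / 3)
        ≤ (192 : ℝ) ^ (-(7 / 3) : ℝ) * (192 * (p : ℝ) ^ 3) ^ ((7 : ℝ) / 3) := by gcongr
      _ = (p : ℝ) ^ 7 := by
        rw [Real.mul_rpow (by norm_num) (by positivity), ← mul_assoc,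
          ← Real.rpow_add (by norm_num), ← Real.rpow_natCast, ← Real.rpow_mul (by positivity),
          ← Real.rpow_natCast]
        norm_num
      _ ≤ (tripleHypergraph φ).card := by exact_mod_cast hcard
  · intro H h3 hfree
    have hn' : (1 : ℝ) ≤ n := by exact_mod_cast (by omega : 1 ≤ n)
    have ht : (1 : ℝ) ≤ (n : ℝ) ^ ((1 : ℝ) / 3) := Real.one_le_rpow hn' (by norm_num)
    have h := card_le_of_not_hasHypCopy h3 hfree ht (by
      rw [Fintype.card_fin, ← Real.rpow_natCast, ← Real.rpow_mul (by positivity)]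
      norm_num)
    rw [Fintype.card_fin] at h
    calc (H.card : ℝ) ≤ 2 * (12 + 3 * (n : ℝ) ^ ((1 : ℝ) / 3)) * (n : ℝ) ^ 2 := h
      _ ≤ 2 * (15 * (n : ℝ) ^ ((1 : ℝ) / 3)) * (n : ℝ) ^ 2 := by gcongr; linarith
      _ = 30 * ((n : ℝ) ^ ((1 : ℝ) / 3) * (n : ℝ) ^ (2 : ℝ)) := by
        rw [Real.rpow_two]; ring
      _ = 30 * (n : ℝ) ^ ((7 : ℝ) / 3) := by
        rw [← Real.rpow_add (by linarith)]; norm_num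

end Paper
end

section
/- For any prime power q and integer k ≥ 2, the bipartite graph D(k,q) is q-regular with 2q^k vertices, and its girth is at least k+4 if k is even and at least k+5 if k is odd; that is, D(k,q) contains no cycle of length less than k+4 (respectively k+5). -/
open scoped Classical

namespace Paper

open PowerSeries in
/-- The continuant-like power series with `ρ 0 ≡ cont (i+1) * ρ (i+1) + cont i * ρ (i+2)` for every
sequence `ρ` obeying the three-term recurrence of `dvd_cont`. -/
noncomputable def cont {F : Type*} [Field F] (d : ℕ → F) : ℕ → PowerSeries F
  | 0 => 1
  | 1 => -C (d 0 - d 2)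
  | i + 2 => cont d i - C (d (i + 1) - d (i + 3)) * ((if Even i then X else 1) * cont d (i + 1))

section Continuant

variable {F : Type*} [Field F]

open PowerSeries

theorem coeff_cont_eq_zero (d : ℕ → F) (i j : ℕ) (h : i / 2 < j) : coeff j (cont d i) = 0 := by
  induction i using Nat.twoStepInduction generalizing j with
  | zero => rw [cont, coeff_one, if_neg (by omega)]
  | one => rw [cont, map_neg, coeff_C, if_neg (by omega), neg_zero]
  | more i ih₁ ih₂ =>
    obtain ⟨j, rfl⟩ : ∃ l, j = l + 1 := ⟨j - 1, by omega⟩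
    rw [cont, map_sub, coeff_C_mul, ih₁ _ (by omega)]
    split_ifs with hi
    · rw [coeff_succ_X_mul, ih₂ _ (by rw [Nat.even_iff] at hi; omega), mul_zero, sub_zero]
    · rw [one_mul, ih₂ _ (by rw [Nat.not_even_iff] at hi; omega), mul_zero, sub_zero]

theorem coeff_cont_ne_zero (d : ℕ → F) (i : ℕ) (h : ∀ j < i, d j ≠ d (j + 2)) :
    coeff (i / 2) (cont d i) ≠ 0 := by
  induction i using Nat.twoStepInduction with
  | zero => simp [cont]
  | one => simpa [cont, sub_eq_zero] using (h 0 one_pos).symm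
  | more i _ ih =>
    have ih := ih fun j hj => h j (by omega)
    have hd := sub_ne_zero.2 (h (i + 1) (by omega))
    rw [show (i + 2) / 2 = i / 2 + 1 by omega, cont, map_sub, coeff_C_mul,
      coeff_cont_eq_zero d i _ (by omega), zero_sub, neg_ne_zero]
    refine mul_ne_zero hd ?_
    split_ifs with hi
    · rw [coeff_succ_X_mul]
      rwa [show (i + 1) / 2 = i / 2 by rw [Nat.even_iff] at hi; omega] at ih
    · rw [one_mul]
      rwa [show (i + 1) / 2 = i / 2 + 1 by rw [Nat.not_even_iff] at hi; omega] at ih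

theorem dvd_cont (d : ℕ → F) (P : PowerSeries F) (L : ℕ) (ρ : ℕ → PowerSeries F)
    (hρ : ∀ i, i + 2 ≤ L → P ∣ ρ (i + 2) - ρ i -
      C (d i - d (i + 2)) * ((if Even i then 1 else X) * ρ (i + 1)))
    (i : ℕ) (hi : i + 2 ≤ L) :
    P ∣ cont d (i + 1) * ρ (i + 1) + cont d i * ρ (i + 2) - ρ 0 := by
  induction i with
  | zero =>
    refine (hρ 0 hi).trans (dvd_of_eq ?_)
    simp [cont]
    ring
  | succ i ih =>
    have h₁ := ih (by omega)
    have h₂ := (hρ (i + 1) hi).mul_left (cont d (i + 1))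
    refine (dvd_add h₁ h₂).trans (dvd_of_eq ?_)
    rw [cont]
    by_cases h : Even i <;> simp [h, Nat.even_add_one] <;> ring

/-- A closed non-backtracking solution of the recurrence of length `2m` forces a nontrivial linear
relation, independent of `ρ`, between the values at the antipode `m` and at `m + 1`. -/
theorem exists_relation_of_closed (d : ℕ → F) (m : ℕ) (hm : 2 ≤ m)
    (hd : ∀ i, i + 2 ≤ 2 * m → d i ≠ d (i + 2)) :
    ∃ α β : PowerSeries F, coeff (m / 2) α ≠ 0 ∧
      ∀ (P : PowerSeries F) (ρ : ℕ → PowerSeries F), ρ (2 * m) = ρ 0 →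
        (∀ i, i + 2 ≤ 2 * m → P ∣ ρ (i + 2) - ρ i -
          C (d i - d (i + 2)) * ((if Even i then 1 else X) * ρ (i + 1))) →
        P ∣ α * ρ m + β * ρ (m + 1) := by
  obtain ⟨l, rfl⟩ : ∃ l, m = l + 2 := ⟨m - 2, by omega⟩
  let d' : ℕ → F := fun i => d (2 * (l + 2) - i)
  refine ⟨cont d (l + 2) - cont d' l, cont d (l + 1) - cont d' (l + 1), ?_, ?_⟩
  · rw [map_sub, coeff_cont_eq_zero d' l _ (by omega), sub_zero]
    exact coeff_cont_ne_zero d _ fun j hj => hd j (by omega)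
  · intro P ρ hclosed hρ
    have h₁ := dvd_cont d P _ ρ hρ (l + 1) (by omega)
    have h₂ := dvd_cont d' P (2 * (l + 2)) (fun i => ρ (2 * (l + 2) - i)) (fun i hi => by
      obtain ⟨j, hj⟩ : ∃ j, 2 * (l + 2) = i + 2 + j := ⟨2 * (l + 2) - (i + 2), by omega⟩
      have h := (hρ j (by omega)).neg_right
      have he : Even j ↔ Even i := by rw [Nat.even_iff, Nat.even_iff]; omega
      simp only [d', show 2 * (l + 2) - i = j + 2 by omega,
        show 2 * (l + 2) - (i + 2) = j by omega, show 2 * (l + 2) - (i + 1) = j + 1 by omega]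
      refine h.trans (dvd_of_eq ?_)
      simp only [he, map_sub]
      ring) l (by omega)
    simp only [show 2 * (l + 2) - (l + 1) = l + 3 by omega,
      show 2 * (l + 2) - (l + 2) = l + 2 by omega, Nat.sub_zero, hclosed] at h₂
    refine (dvd_sub h₁ h₂).trans (dvd_of_eq ?_)
    ring

end Continuant

theorem aIdx_of_mod {j : ℕ} (hj : 4 ≤ j) :
    aIdx j = if j % 4 = 0 ∨ j % 4 = 3 then j - 2 else 0 := by
  obtain ⟨i, rfl⟩ := Nat.exists_eq_add_of_le' hj
  rfl

theorem bIdx_of_mod {j : ℕ} (hj : 4 ≤ j) :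
    bIdx j = if j % 4 = 0 ∨ j % 4 = 3 then 0 else j - 2 := by
  obtain ⟨i, rfl⟩ := Nat.exists_eq_add_of_le' hj
  rfl

section Rows

variable {F : Type*} [Field F]

open PowerSeries

/-- The coordinates `x_1, x_{12}, x_{23}, …` of a vertex in part `A`. -/
noncomputable def rowA₁ (a : ℕ → F) : PowerSeries F :=
  mk fun | 0 => a 0 | j + 1 => a (4 * j + 2)

/-- The coordinates `-1, x_{11}, x'_{22}, x'_{33}, …` of a vertex in part `A`. -/
noncomputable def rowA₂ (a : ℕ → F) : PowerSeries F :=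
  mk fun | 0 => -1 | j + 1 => a (4 * j + 1)

/-- The coordinates `-1, x_{11}, x_{22}, x_{33}, …` of a vertex in part `B`. -/
noncomputable def rowB₁ (b : ℕ → F) : PowerSeries F :=
  mk fun | 0 => -1 | 1 => b 1 | j + 2 => b (4 * j + 4)

/-- The coordinates `0, x_1, x_{21}, x_{32}, …` of a vertex in part `B`. -/
noncomputable def rowB₂ (b : ℕ → F) : PowerSeries F :=
  mk fun | 0 => 0 | 1 => b 0 | j + 2 => b (4 * j + 3)

theorem isUnit_det_rows (a b : ℕ → F) :
    IsUnit (rowB₁ b * rowA₂ a - rowB₂ b * rowA₁ a) := by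
  rw [isUnit_iff_constantCoeff]
  simp only [map_sub, map_mul, ← coeff_zero_eq_constantCoeff_apply, rowA₁, rowA₂, rowB₁, rowB₂,
    coeff_mk]
  simp

variable {k : ℕ} {a a' b b' : Fin k → F}

theorem dvd_rowA₁_sub (h : Drel k F a b) (h' : Drel k F a' b) {n : ℕ} (hn : 4 * n < k + 6) :
    X ^ n ∣ rowA₁ (ext a') - rowA₁ (ext a) - C (ext a 0 - ext a' 0) * rowB₁ (ext b) := by
  rw [X_pow_dvd_iff]
  intro j hj
  rw [map_sub, map_sub, coeff_C_mul]
  simp only [rowA₁, rowB₁, coeff_mk]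
  rcases j with _ | _ | j
  · ring
  · have e := h 2 (by omega) (by omega)
    have e' := h' 2 (by omega) (by omega)
    simp only [aIdx, bIdx] at e e'
    simp only
    linear_combination e' - e
  · have e := h (4 * (j + 1) + 2) (by omega) (by omega)
    have e' := h' (4 * (j + 1) + 2) (by omega) (by omega)
    rw [aIdx_of_mod (by omega), bIdx_of_mod (by omega), if_neg (by omega), if_neg (by omega)]
      at e e'
    simp only [show 4 * (j + 1) + 2 - 2 = 4 * j + 4 by omega] at e e'
    linear_combination e' - e

theorem dvd_rowA₂_sub (h : Drel k F a b) (h' : Drel k F a' b) {n : ℕ} (hn : 4 * n < k + 6) :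
    X ^ n ∣ rowA₂ (ext a') - rowA₂ (ext a) - C (ext a 0 - ext a' 0) * rowB₂ (ext b) := by
  rw [X_pow_dvd_iff]
  intro j hj
  rw [map_sub, map_sub, coeff_C_mul]
  simp only [rowA₂, rowB₂, coeff_mk]
  rcases j with _ | _ | j
  · ring
  · have e := h 1 (by omega) (by omega)
    have e' := h' 1 (by omega) (by omega)
    simp only [aIdx, bIdx] at e e'
    simp only
    linear_combination e' - e
  · have e := h (4 * (j + 1) + 1) (by omega) (by omega)
    have e' := h' (4 * (j + 1) + 1) (by omega) (by omega)
    rw [aIdx_of_mod (by omega), bIdx_of_mod (by omega), if_neg (by omega), if_neg (by omega)]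
      at e e'
    simp only [show 4 * (j + 1) + 1 - 2 = 4 * j + 3 by omega] at e e'
    linear_combination e' - e

theorem dvd_rowB₁_sub (hk : 2 ≤ k) (h : Drel k F a b) (h' : Drel k F a b') {n : ℕ}
    (hn : 4 * n < k + 8) :
    X ^ n ∣ rowB₁ (ext b') - rowB₁ (ext b) - C (ext b 0 - ext b' 0) * (X * rowA₁ (ext a)) := by
  rw [X_pow_dvd_iff]
  intro j hj
  rw [map_sub, map_sub, coeff_C_mul]
  rcases j with _ | _ | j
  · simp [rowB₁, coeff_zero_X_mul]
  · have e := h 1 (by omega) (by omega)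
    have e' := h' 1 (by omega) (by omega)
    simp only [aIdx, bIdx] at e e'
    simp only [coeff_succ_X_mul, rowA₁, rowB₁, coeff_mk]
    linear_combination e' - e
  · have e := h (4 * j + 4) (by omega) (by omega)
    have e' := h' (4 * j + 4) (by omega) (by omega)
    rw [aIdx_of_mod (by omega), bIdx_of_mod (by omega), if_pos (by omega), if_pos (by omega)]
      at e e'
    simp only [show 4 * j + 4 - 2 = 4 * j + 2 by omega] at e e'
    simp only [coeff_succ_X_mul, rowA₁, rowB₁, coeff_mk]
    linear_combination e' - e

theorem dvd_rowB₂_sub (h : Drel k F a b) (h' : Drel k F a b') {n : ℕ}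
    (hn : 4 * n < k + 8) :
    X ^ n ∣ rowB₂ (ext b') - rowB₂ (ext b) - C (ext b 0 - ext b' 0) * (X * rowA₂ (ext a)) := by
  rw [X_pow_dvd_iff]
  intro j hj
  rw [map_sub, map_sub, coeff_C_mul]
  rcases j with _ | _ | _ | j
  · simp [rowB₂, coeff_zero_X_mul]
  · simp only [coeff_succ_X_mul, rowA₂, rowB₂, coeff_mk]
    ring
  · have e := h 3 (by omega) (by omega)
    have e' := h' 3 (by omega) (by omega)
    simp only [aIdx, bIdx] at e e'
    simp only [coeff_succ_X_mul, rowA₂, rowB₂, coeff_mk]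
    linear_combination e' - e
  · have e := h (4 * (j + 1) + 3) (by omega) (by omega)
    have e' := h' (4 * (j + 1) + 3) (by omega) (by omega)
    rw [aIdx_of_mod (by omega), bIdx_of_mod (by omega), if_pos (by omega), if_pos (by omega)]
      at e e'
    simp only [show 4 * (j + 1) + 3 - 2 = 4 * (j + 1) + 1 by omega] at e e'
    simp only [coeff_succ_X_mul, rowA₂, rowB₂, coeff_mk]
    linear_combination e' - e

end Rows

section Graph

variable {k : ℕ} {F : Type*} [Field F]

theorem dGraph_adj_inl_inr {a b : Fin k → F} :
    (DGraph k F).Adj (Sum.inl a) (Sum.inr b) ↔ Drel k F a b := by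
  simp [DGraph]

theorem dGraph_not_adj_inl_inl {a a' : Fin k → F} :
    ¬ (DGraph k F).Adj (Sum.inl a) (Sum.inl a') := by
  simp [DGraph]

theorem dGraph_not_adj_inr_inr {b b' : Fin k → F} :
    ¬ (DGraph k F).Adj (Sum.inr b) (Sum.inr b') := by
  simp [DGraph]

/-- The first coordinate of a vertex. -/
def firstCoord (v : (Fin k → F) ⊕ (Fin k → F)) : F :=
  v.elim (fun a => ext a 0) (fun b => ext b 0)

theorem ext_injective {s t : Fin k → F} (h : ∀ j < k, ext s j = ext t j) : s = t := by
  funext i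
  simpa [ext] using h i i.2

theorem eq_of_recurrence (c g : ℕ → F) (σ : ℕ → ℕ) (hσ : ∀ j, 1 ≤ j → σ j < j)
    {s t : Fin k → F} (h₀ : ext s 0 = ext t 0)
    (hs : ∀ j, 1 ≤ j → j < k → ext s j = c j + g j * ext s (σ j))
    (ht : ∀ j, 1 ≤ j → j < k → ext t j = c j + g j * ext t (σ j)) : s = t := by
  refine ext_injective fun j => ?_
  induction j using Nat.strong_induction_on with
  | _ j ih =>
    intro hj
    rcases Nat.eq_zero_or_pos j with rfl | hpos
    · exact h₀
    · rw [hs j hpos hj, ht j hpos hj, ih _ (hσ j hpos) ((hσ j hpos).trans hj)]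

theorem exists_recurrence (hk : 0 < k) (c g : ℕ → F) (σ : ℕ → ℕ) (hσ : ∀ j, 1 ≤ j → σ j < j)
    (y : F) :
    ∃ s : Fin k → F, ext s 0 = y ∧ ∀ j, 1 ≤ j → j < k → ext s j = c j + g j * ext s (σ j) := by
  have key : ∀ n, ∃ s : ℕ → F, s 0 = y ∧ ∀ j, 1 ≤ j → j < n → s j = c j + g j * s (σ j) := by
    intro n
    induction n with
    | zero => exact ⟨fun _ => y, rfl, by omega⟩
    | succ n ih =>
      obtain ⟨s, h₀, hs⟩ := ih
      rcases Nat.eq_zero_or_pos n with rfl | hn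
      · exact ⟨s, h₀, by omega⟩
      refine ⟨Function.update s n (c n + g n * s (σ n)), ?_, fun j hj hjn => ?_⟩
      · rw [Function.update_of_ne hn.ne, h₀]
      · have := hσ j hj
        rw [Function.update_of_ne (show σ j ≠ n by omega)]
        rcases eq_or_ne j n with rfl | hne
        · rw [Function.update_self]
        · rw [Function.update_of_ne hne, hs j hj (by omega)]
  obtain ⟨s, h₀, hs⟩ := key k
  have he : ∀ j < k, ext (fun i : Fin k => s i) j = s j := fun j hj => by simp [ext, hj]
  refine ⟨fun i => s i, by rw [he 0 hk, h₀], fun j hj hjk => ?_⟩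
  rw [he j hjk, he _ ((hσ j hj).trans hjk), hs j hj hjk]

theorem eq_of_adj_of_firstCoord_eq {u v v' : (Fin k → F) ⊕ (Fin k → F)}
    (h : (DGraph k F).Adj u v) (h' : (DGraph k F).Adj u v')
    (h₀ : firstCoord v = firstCoord v') : v = v' := by
  rcases u with a | b <;> rcases v with v | v <;> rcases v' with v' | v'
  · exact (dGraph_not_adj_inl_inl h).elim
  · exact (dGraph_not_adj_inl_inl h).elim
  · exact (dGraph_not_adj_inl_inl h').elim
  · rw [dGraph_adj_inl_inr] at h h'
    rw [eq_of_recurrence (fun j => -ext a j) (fun j => -ext a (aIdx j)) bIdx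
      (fun _ => bIdx_lt) h₀ (fun j h1 h2 => by linear_combination h j h1 h2)
      (fun j h1 h2 => by linear_combination h' j h1 h2)]
  · rw [SimpleGraph.adj_comm, dGraph_adj_inl_inr] at h h'
    rw [eq_of_recurrence (fun j => -ext b j) (fun j => -ext b (bIdx j)) aIdx
      (fun _ => aIdx_lt) h₀ (fun j h1 h2 => by linear_combination h j h1 h2)
      (fun j h1 h2 => by linear_combination h' j h1 h2)]
  · exact (dGraph_not_adj_inr_inr h').elim
  · exact (dGraph_not_adj_inr_inr h).elim
  · exact (dGraph_not_adj_inr_inr h).elim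

theorem exists_adj_firstCoord_eq (hk : 0 < k) (u : (Fin k → F) ⊕ (Fin k → F)) (y : F) :
    ∃ v, (DGraph k F).Adj u v ∧ firstCoord v = y := by
  rcases u with a | b
  · obtain ⟨s, h₀, hs⟩ := exists_recurrence hk (fun j => -ext a j) (fun j => -ext a (aIdx j)) bIdx
      (fun _ => bIdx_lt) y
    exact ⟨Sum.inr s, dGraph_adj_inl_inr.2 fun j h1 h2 => by linear_combination hs j h1 h2, h₀⟩
  · obtain ⟨s, h₀, hs⟩ := exists_recurrence hk (fun j => -ext b j) (fun j => -ext b (bIdx j)) aIdx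
      (fun _ => aIdx_lt) y
    exact ⟨Sum.inl s,
      (dGraph_adj_inl_inr.2 fun j h1 h2 => by linear_combination hs j h1 h2).symm, h₀⟩

theorem ncard_neighborSet_dGraph [Fintype F] (hk : 0 < k) (v : (Fin k → F) ⊕ (Fin k → F)) :
    ((DGraph k F).neighborSet v).ncard = Fintype.card F := by
  rw [← Nat.card_coe_set_eq, ← Nat.card_eq_fintype_card]
  refine Nat.card_eq_of_bijective (fun u => firstCoord u.1) ⟨fun u u' h => ?_, fun y => ?_⟩
  · exact Subtype.ext (eq_of_adj_of_firstCoord_eq u.2 u'.2 h)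
  · obtain ⟨u, hu, hy⟩ := exists_adj_firstCoord_eq hk v y
    exact ⟨⟨u, hu⟩, hy⟩

theorem isRight_of_adj {u v : (Fin k → F) ⊕ (Fin k → F)} (h : (DGraph k F).Adj u v) :
    v.isRight = !u.isRight := by
  rcases u with a | b <;> rcases v with v | v
  · exact (dGraph_not_adj_inl_inl h).elim
  · rfl
  · rfl
  · exact (dGraph_not_adj_inr_inr h).elim

/-- The first row entry attached to a vertex, scaled by `w` in part `A`. -/
noncomputable def row₁ (w : PowerSeries F) (v : (Fin k → F) ⊕ (Fin k → F)) : PowerSeries F :=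
  v.elim (fun a => w * rowA₁ (ext a)) (fun b => rowB₁ (ext b))

/-- The second row entry attached to a vertex, scaled by `w` in part `A`. -/
noncomputable def row₂ (w : PowerSeries F) (v : (Fin k → F) ⊕ (Fin k → F)) : PowerSeries F :=
  v.elim (fun a => w * rowA₂ (ext a)) (fun b => rowB₂ (ext b))

open PowerSeries in
theorem dvd_row_sub (hk : 2 ≤ k) {n : ℕ} {w w' : PowerSeries F} (hw : w * w' = X)
    (hn : 4 * n < k + 8) (hn' : ∃ l, X ^ n ∣ w * X ^ l ∧ 4 * l < k + 6)
    {u v u' : (Fin k → F) ⊕ (Fin k → F)}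
    (h : (DGraph k F).Adj u v) (h' : (DGraph k F).Adj v u') :
    X ^ n ∣ row₁ w u' - row₁ w u - C (firstCoord u - firstCoord u') *
        ((if v.isRight then w else w') * row₁ w v) ∧
      X ^ n ∣ row₂ w u' - row₂ w u - C (firstCoord u - firstCoord u') *
        ((if v.isRight then w else w') * row₂ w v) := by
  obtain ⟨l, hl, hlk⟩ := hn'
  rcases v with a | b <;> rcases u with u | u <;> rcases u' with u' | u'
  · exact (dGraph_not_adj_inl_inl h).elim
  · exact (dGraph_not_adj_inl_inl h).elim
  · exact (dGraph_not_adj_inl_inl h').elim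
  · rw [SimpleGraph.adj_comm, dGraph_adj_inl_inr] at h
    rw [dGraph_adj_inl_inr] at h'
    simp only [row₁, row₂, firstCoord, Sum.elim_inl, Sum.elim_inr, Sum.isRight_inl,
      Bool.false_eq_true, if_false]
    rw [← mul_assoc w', ← mul_assoc w', mul_comm w', hw]
    exact ⟨dvd_rowB₁_sub hk h h' hn, dvd_rowB₂_sub h h' hn⟩
  · rw [dGraph_adj_inl_inr] at h
    rw [SimpleGraph.adj_comm, dGraph_adj_inl_inr] at h'
    simp only [row₁, row₂, firstCoord, Sum.elim_inl, Sum.elim_inr, Sum.isRight_inr, if_true]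
    constructor
    · refine (hl.trans (mul_dvd_mul_left w (dvd_rowA₁_sub h h' hlk))).trans (dvd_of_eq ?_)
      ring
    · refine (hl.trans (mul_dvd_mul_left w (dvd_rowA₂_sub h h' hlk))).trans (dvd_of_eq ?_)
      ring
  · exact (dGraph_not_adj_inr_inr h').elim
  · exact (dGraph_not_adj_inr_inr h).elim
  · exact (dGraph_not_adj_inr_inr h).elim

open PowerSeries in
/-- A closed non-backtracking walk of length `2m`, written as a sequence of vertices and based so
that its antipode lies in part `B`, needs `2m > k + 3`. -/
theorem lt_of_closed_nonbacktracking (hk : 2 ≤ k) {m : ℕ} (hm : 2 ≤ m)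
    (v : ℕ → (Fin k → F) ⊕ (Fin k → F)) (hclosed : v (2 * m) = v 0)
    (hadj : ∀ i < 2 * m, (DGraph k F).Adj (v i) (v (i + 1)))
    (hne : ∀ i, i + 2 ≤ 2 * m → v i ≠ v (i + 2))
    (hside : (v 0).isRight = decide (Even m)) : k + 3 < 2 * m := by
  by_contra! hle
  have hparity : ∀ i ≤ 2 * m, (v i).isRight = decide (Even (i + m)) := by
    intro i
    induction i with
    | zero => intro _; rw [hside, zero_add]
    | succ i ih =>
      intro hi
      rw [isRight_of_adj (hadj i (by omega)), ih (by omega), ← decide_not, add_right_comm]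
      simp only [Nat.even_add_one]
  obtain ⟨α, β, hα, hrel⟩ := exists_relation_of_closed (fun i => firstCoord (v i)) m hm
    fun i hi he => hne i hi
      (eq_of_adj_of_firstCoord_eq (hadj i (by omega)).symm (hadj (i + 1) (by omega)) he)
  obtain ⟨w, w', hw, hl, hs⟩ : ∃ w w' : PowerSeries F, w * w' = X ∧
      (∃ l, X ^ (m / 2 + 1) ∣ w * X ^ l ∧ 4 * l < k + 6) ∧
      ∀ i, (if decide (Even (i + 1 + m)) then w else w') = if Even i then 1 else X := by
    by_cases he : Even m
    · refine ⟨X, 1, mul_one _, ⟨m / 2, by rw [pow_succ'], by omega⟩, fun i => ?_⟩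
      by_cases hi : Even i <;> simp [hi, he, Nat.even_add]
    · have := Nat.not_even_iff.1 he
      refine ⟨1, X, one_mul _, ⟨m / 2 + 1, by rw [one_mul], by omega⟩, fun i => ?_⟩
      by_cases hi : Even i <;> simp [hi, he, Nat.even_add]
  have hstep := fun i (hi : i + 2 ≤ 2 * m) =>
    dvd_row_sub (n := m / 2 + 1) hk hw (by omega) hl (hadj i (by omega)) (hadj (i + 1) (by omega))
  simp only [add_assoc, Nat.reduceAdd] at hstep
  have h₁ := hrel (X ^ (m / 2 + 1)) (fun i => row₁ w (v i)) (by simp only [hclosed])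
    fun i hi => by
      have := (hstep i hi).1
      rwa [hparity (i + 1) (by omega), hs] at this
  have h₂ := hrel (X ^ (m / 2 + 1)) (fun i => row₂ w (v i)) (by simp only [hclosed])
    fun i hi => by
      have := (hstep i hi).2
      rwa [hparity (i + 1) (by omega), hs] at this
  obtain ⟨b, hb⟩ : ∃ b, v m = Sum.inr b := by
    rw [← Sum.isRight_iff, hparity m (by omega)]
    simp
  obtain ⟨a, ha⟩ : ∃ a, v (m + 1) = Sum.inl a := by
    rw [← Sum.isLeft_iff, ← Sum.bnot_isRight, hparity (m + 1) (by omega)]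
    rw [show m + 1 + m = 2 * m + 1 by omega]
    simp
  simp only [ha, hb, row₁, row₂, Sum.elim_inl, Sum.elim_inr] at h₁ h₂
  have hdvd : X ^ (m / 2 + 1) ∣
      α * (rowB₁ (ext b) * rowA₂ (ext a) - rowB₂ (ext b) * rowA₁ (ext a)) := by
    refine (dvd_sub (h₁.mul_right (rowA₂ (ext a))) (h₂.mul_right (rowA₁ (ext a)))).trans
      (dvd_of_eq ?_)
    ring
  rw [(isUnit_det_rows _ _).dvd_mul_right, X_pow_dvd_iff] at hdvd
  exact hα (hdvd _ (Nat.lt_succ_self _))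

theorem even_length_of_closed {u : (Fin k → F) ⊕ (Fin k → F)} (p : (DGraph k F).Walk u u) :
    Even p.length := by
  have key : ∀ i ≤ p.length, (p.getVert i).isRight = (u.isRight ^^ decide (¬ Even i)) := by
    intro i
    induction i with
    | zero => simp
    | succ i ih =>
      intro hi
      rw [isRight_of_adj (p.adj_getVert_succ (by omega)), ih (by omega)]
      by_cases h : Even i <;> simp [h, Nat.even_add_one]
  have h := key _ le_rfl
  rw [p.getVert_length] at h
  by_contra ho
  cases hu : u.isRight <;> simp [ho, hu] at h

theorem lt_length_of_isCycle (hk : 2 ≤ k) {u : (Fin k → F) ⊕ (Fin k → F)}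
    (p : (DGraph k F).Walk u u) (hp : p.IsCycle) : k + 3 < p.length := by
  obtain ⟨m, hm⟩ := (even_length_of_closed p).two_dvd
  have h3 := hp.three_le_length
  obtain ⟨u', p', hp', hlen, hside⟩ : ∃ (u' : (Fin k → F) ⊕ (Fin k → F))
      (p' : (DGraph k F).Walk u' u'), p'.IsCycle ∧ p'.length = p.length ∧
        u'.isRight = decide (Even m) := by
    by_cases h : u.isRight = decide (Even m)
    · exact ⟨u, p, hp, rfl, h⟩
    · have hadj := p.adj_getVert_succ (i := 0) (by omega)
      have hmem : p.getVert 1 ∈ p.support := p.getVert_mem_support 1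
      refine ⟨p.getVert 1, p.rotate _ hmem, hp.rotate hmem, ?_, ?_⟩
      · simp
      · rw [p.getVert_zero] at hadj
        rw [isRight_of_adj hadj]
        revert h
        cases u.isRight <;> cases decide (Even m) <;> simp
  rw [← hlen] at hm h3 ⊢
  rw [hm]
  refine lt_of_closed_nonbacktracking hk (by omega) p'.getVert ?_ ?_ ?_ ?_
  · rw [← hm, p'.getVert_length, p'.getVert_zero]
  · exact fun i hi => p'.adj_getVert_succ (by omega)
  · intro i hi he
    rcases Nat.eq_zero_or_pos i with rfl | hpos
    · have := hp'.getVert_injOn' (show 0 ≤ p'.length - 1 by omega)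
        (show 0 + 2 ≤ p'.length - 1 by omega) he
      omega
    · have := hp'.getVert_injOn (show i ∈ {i | 1 ≤ i ∧ i ≤ p'.length} from ⟨hpos, by omega⟩)
        (show i + 2 ∈ {i | 1 ≤ i ∧ i ≤ p'.length} from ⟨by omega, by omega⟩) he
      omega
  · rw [p'.getVert_zero, hside]

end Graph

/-- For any prime power `q` and `k ≥ 2`, the graph `D(k,q)` is `q`-regular
with `2q^k` vertices, and its girth is at least `k+4` if `k` is even and `k+5` if `k` is odd. -/
theorem DGraph_regular_girth (k : ℕ) (hk : 2 ≤ k) (F : Type) [Field F] [Fintype F] :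
    Fintype.card ((Fin k → F) ⊕ (Fin k → F)) = 2 * Fintype.card F ^ k ∧
    (∀ v : (Fin k → F) ⊕ (Fin k → F),
      ((DGraph k F).neighborSet v).ncard = Fintype.card F) ∧
    (if Even k then ((k : ℕ∞) + 4) else ((k : ℕ∞) + 5)) ≤ (DGraph k F).egirth := by
  refine ⟨?_, ncard_neighborSet_dGraph (by omega), ?_⟩
  · rw [Fintype.card_sum, Fintype.card_fun, Fintype.card_fin, two_mul]
  · rw [SimpleGraph.le_egirth]
    intro u p hp
    have hlt := lt_length_of_isCycle hk p hp
    have hev := even_length_of_closed p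
    split_ifs with h
    · exact_mod_cast (show k + 4 ≤ p.length by omega)
    · rw [Nat.even_iff] at h hev
      exact_mod_cast (show k + 5 ≤ p.length by omega)

end Paper
end
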